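/- arXiv:2105.14714 — 2 statements merged into one kernel-verified Lean document; each statement's English description precedes it below -/
import Mathlib

section
/- Let α ∈ ℝ and R̄ : V → ℝ with α R̄_i ≤ 0 for all i ∈ V. Suppose f_A ∈ ℝᴺ is admissible (its u-coordinate lies in U^H) and f_B ∈ ℝᴺ is arbitrary, and they have the same extended combinatorial α-curvature: R̃_{α,i}(f_A) = R̃_{α,i}(f_B) = R̄_i for all i. Then f_A = f_B. -/
open Real

/-- A combinatorial triangulation of a connected closed surface on the vertex set
`Fin N`: a nonempty set of triangular faces covering all vertices, such that every
edge (2-element subset of a face) lies in exactly two faces and the underlying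
graph is connected. -/
structure TriSurface (N : ℕ) where
  /-- The set of faces, each a 3-element subset of the vertex set. -/
  F : Finset (Finset (Fin N))
  F_nonempty : F.Nonempty
  card_face : ∀ σ ∈ F, σ.card = 3
  vertex_cover : ∀ v : Fin N, ∃ σ ∈ F, v ∈ σ
  edge_two_faces : ∀ e : Finset (Fin N), e.card = 2 → (∃ σ ∈ F, e ⊆ σ) →
    (F.filter fun σ => e ⊆ σ).card = 2
  connected : (SimpleGraph.fromRel fun i j => ∃ σ ∈ F, i ∈ σ ∧ j ∈ σ).Connected

namespace TriSurface

variable {N : ℕ}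

/-- The edge set: all 2-element subsets of faces. -/
def edges (S : TriSurface N) : Finset (Finset (Fin N)) :=
  S.F.biUnion fun σ => Finset.powersetCard 2 σ

/-- The Euler characteristic `χ = N - |E| + |F|`. -/
def chi (S : TriSurface N) : ℤ :=
  (N : ℤ) - (S.edges.card : ℤ) + (S.F.card : ℤ)

/-- Weights on a triangulated surface: scheme coefficients `ε : V → {0,1}` and symmetric
discrete conformal structure coefficients `η : E → ℝ`, subject to the structure conditions
`ε_s ε_t + η_st > 0` on every edge and `ε_q η_st + η_qs η_qt ≥ 0` in every face. -/
structure Weights (S : TriSurface N) where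
  eps : Fin N → ℝ
  eta : Fin N → Fin N → ℝ
  eps01 : ∀ i, eps i = 0 ∨ eps i = 1
  eta_symm : ∀ i j, eta i j = eta j i
  structCond1 : ∀ i j : Fin N, ({i, j} : Finset (Fin N)) ∈ S.edges →
    eps i * eps j + eta i j > 0
  structCond2 : ∀ i j k : Fin N, ({i, j, k} : Finset (Fin N)) ∈ S.F →
    i ≠ j → i ≠ k → j ≠ k → eps i * eta j k + eta i j * eta i k ≥ 0

variable {S : TriSurface N}

/-! ### Euclidean background -/

/-- Euclidean edge length `l_ij = sqrt(ε_i e^{2u_i} + ε_j e^{2u_j} + 2 η_ij e^{u_i+u_j})`. -/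
noncomputable def lE (W : Weights S) (u : Fin N → ℝ) (i j : Fin N) : ℝ :=
  Real.sqrt (W.eps i * exp (2 * u i) + W.eps j * exp (2 * u j) +
    2 * W.eta i j * exp (u i + u j))

/-- The admissible space `U^E`: discrete conformal factors for which every face satisfies
the strict triangle inequalities. -/
def admissibleE (W : Weights S) (u : Fin N → ℝ) : Prop :=
  ∀ i j k : Fin N, ({i, j, k} : Finset (Fin N)) ∈ S.F →
    lE W u i j + lE W u i k > lE W u j k

/-- The inner angle `θ_i^{jk}` at `i` in the face `{i,j,k}`, by the law of cosines. -/
noncomputable def thetaE (W : Weights S) (u : Fin N → ℝ) (i j k : Fin N) : ℝ :=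
  arccos ((lE W u i j ^ 2 + lE W u i k ^ 2 - lE W u j k ^ 2) /
    (2 * lE W u i j * lE W u i k))

open Classical in
/-- The extended inner angle `θ̃_i^{jk}`: equal to `θ_i^{jk}` when the three strict triangle
inequalities hold in the face, to `π` when the edge opposite to `i` dominates, and to `0`
otherwise. -/
noncomputable def thetaExE (W : Weights S) (u : Fin N → ℝ) (i j k : Fin N) : ℝ :=
  if lE W u i j + lE W u i k > lE W u j k ∧ lE W u i j + lE W u j k > lE W u i k ∧
      lE W u i k + lE W u j k > lE W u i j then thetaE W u i j k
  else if lE W u j k ≥ lE W u i j + lE W u i k then π else 0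

open Classical in
/-- The angle at `i` in a face `σ` containing `i` (the half-sum over the two orderings of
the remaining two vertices; the angle is symmetric in the last two arguments). -/
noncomputable def faceAngleE (W : Weights S) (u : Fin N → ℝ) (i : Fin N)
    (σ : Finset (Fin N)) : ℝ :=
  (1 / 2) * ∑ j ∈ σ.erase i, ∑ k ∈ (σ.erase i).erase j, thetaE W u i j k

open Classical in
/-- The extended angle at `i` in a face `σ` containing `i`. -/
noncomputable def faceAngleExE (W : Weights S) (u : Fin N → ℝ) (i : Fin N)
    (σ : Finset (Fin N)) : ℝ :=
  (1 / 2) * ∑ j ∈ σ.erase i, ∑ k ∈ (σ.erase i).erase j, thetaExE W u i j k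

open Classical in
/-- The classical combinatorial curvature `K_i = 2π − Σ θ_i^{jk}`. -/
noncomputable def KE (W : Weights S) (u : Fin N → ℝ) (i : Fin N) : ℝ :=
  2 * π - ∑ σ ∈ S.F.filter (fun σ => i ∈ σ), faceAngleE W u i σ

open Classical in
/-- The extended combinatorial curvature `K̃_i = 2π − Σ θ̃_i^{jk}`. -/
noncomputable def KExE (W : Weights S) (u : Fin N → ℝ) (i : Fin N) : ℝ :=
  2 * π - ∑ σ ∈ S.F.filter (fun σ => i ∈ σ), faceAngleExE W u i σ

/-- The combinatorial `α`-curvature `R_{α,i} = K_i e^{−α u_i}` (Euclidean background). -/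
noncomputable def RE (W : Weights S) (α : ℝ) (u : Fin N → ℝ) (i : Fin N) : ℝ :=
  KE W u i * exp (-(α * u i))

/-- The extended combinatorial `α`-curvature `R̃_{α,i} = K̃_i e^{−α u_i}` (Euclidean). -/
noncomputable def RExE (W : Weights S) (α : ℝ) (u : Fin N → ℝ) (i : Fin N) : ℝ :=
  KExE W u i * exp (-(α * u i))

/-- The Jacobian `∂K_i/∂u_j` of the curvature map in the Euclidean background. -/
noncomputable def DKE (W : Weights S) (u : Fin N → ℝ) (i j : Fin N) : ℝ :=
  fderiv ℝ (fun v => KE W v i) u (Pi.single j 1)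

/-- The discrete `α`-Laplacian `(Δ_α g)_i = −e^{−α u_i} Σ_j (∂K_i/∂u_j) g_j` (Euclidean). -/
noncomputable def LapE (W : Weights S) (α : ℝ) (u : Fin N → ℝ) (g : Fin N → ℝ)
    (i : Fin N) : ℝ :=
  -exp (-(α * u i)) * ∑ j, DKE W u i j * g j

/-! ### Hyperbolic background -/

/-- The inverse hyperbolic cosine. -/
noncomputable def arcosh (x : ℝ) : ℝ := Real.log (x + Real.sqrt (x ^ 2 - 1))

/-- Hyperbolic edge length
`l_ij = arcosh(sqrt((1+ε_i e^{2f_i})(1+ε_j e^{2f_j})) + η_ij e^{f_i+f_j})`. -/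
noncomputable def lH (W : Weights S) (f : Fin N → ℝ) (i j : Fin N) : ℝ :=
  arcosh (Real.sqrt ((1 + W.eps i * exp (2 * f i)) * (1 + W.eps j * exp (2 * f j))) +
    W.eta i j * exp (f i + f j))

open Classical in
/-- The coordinate change `f ↦ u` at a vertex with scheme coefficient `e`. -/
noncomputable def ucoord (e x : ℝ) : ℝ :=
  if e = 0 then x
  else (1 / 2) * Real.log ((Real.sqrt (1 + exp (2 * x)) - 1) / (Real.sqrt (1 + exp (2 * x)) + 1))

/-- The discrete conformal structure `u` associated to the conformal factor `f`
(hyperbolic background). -/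
noncomputable def uOf (W : Weights S) (f : Fin N → ℝ) (i : Fin N) : ℝ :=
  ucoord (W.eps i) (f i)

/-- The admissible space `U^H` (described in the `f`-coordinates): every face satisfies
the strict triangle inequalities. -/
def admissibleH (W : Weights S) (f : Fin N → ℝ) : Prop :=
  ∀ i j k : Fin N, ({i, j, k} : Finset (Fin N)) ∈ S.F →
    lH W f i j + lH W f i k > lH W f j k

/-- The inner angle `θ_i^{jk}` at `i` in the hyperbolic face `{i,j,k}`, by the hyperbolic
law of cosines. -/
noncomputable def thetaH (W : Weights S) (f : Fin N → ℝ) (i j k : Fin N) : ℝ :=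
  arccos ((Real.cosh (lH W f i j) * Real.cosh (lH W f i k) - Real.cosh (lH W f j k)) /
    (Real.sinh (lH W f i j) * Real.sinh (lH W f i k)))

open Classical in
/-- The extended hyperbolic inner angle `θ̃_i^{jk}`. -/
noncomputable def thetaExH (W : Weights S) (f : Fin N → ℝ) (i j k : Fin N) : ℝ :=
  if lH W f i j + lH W f i k > lH W f j k ∧ lH W f i j + lH W f j k > lH W f i k ∧
      lH W f i k + lH W f j k > lH W f i j then thetaH W f i j k
  else if lH W f j k ≥ lH W f i j + lH W f i k then π else 0

open Classical in
/-- The angle at `i` in a hyperbolic face `σ` containing `i`. -/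
noncomputable def faceAngleH (W : Weights S) (f : Fin N → ℝ) (i : Fin N)
    (σ : Finset (Fin N)) : ℝ :=
  (1 / 2) * ∑ j ∈ σ.erase i, ∑ k ∈ (σ.erase i).erase j, thetaH W f i j k

open Classical in
/-- The extended angle at `i` in a hyperbolic face `σ` containing `i`. -/
noncomputable def faceAngleExH (W : Weights S) (f : Fin N → ℝ) (i : Fin N)
    (σ : Finset (Fin N)) : ℝ :=
  (1 / 2) * ∑ j ∈ σ.erase i, ∑ k ∈ (σ.erase i).erase j, thetaExH W f i j k

open Classical in
/-- The classical combinatorial curvature (hyperbolic background). -/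
noncomputable def KH (W : Weights S) (f : Fin N → ℝ) (i : Fin N) : ℝ :=
  2 * π - ∑ σ ∈ S.F.filter (fun σ => i ∈ σ), faceAngleH W f i σ

open Classical in
/-- The extended combinatorial curvature (hyperbolic background). -/
noncomputable def KExH (W : Weights S) (f : Fin N → ℝ) (i : Fin N) : ℝ :=
  2 * π - ∑ σ ∈ S.F.filter (fun σ => i ∈ σ), faceAngleExH W f i σ

/-- The combinatorial `α`-curvature `R_{α,i} = K_i e^{−α u_i}` (hyperbolic background),
expressed as a function of the conformal factor `f`. -/
noncomputable def RH (W : Weights S) (α : ℝ) (f : Fin N → ℝ) (i : Fin N) : ℝ :=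
  KH W f i * exp (-(α * uOf W f i))

/-- The extended combinatorial `α`-curvature `R̃_{α,i} = K̃_i e^{−α u_i}` (hyperbolic). -/
noncomputable def RExH (W : Weights S) (α : ℝ) (f : Fin N → ℝ) (i : Fin N) : ℝ :=
  KExH W f i * exp (-(α * uOf W f i))

/-- The Jacobian `∂K_i/∂u_j` in the hyperbolic background, computed by the chain rule from
the `f`-coordinates: `(∂K_i/∂f_j) / (du_j/df_j)`. -/
noncomputable def DKH (W : Weights S) (f : Fin N → ℝ) (i j : Fin N) : ℝ :=
  fderiv ℝ (fun g => KH W g i) f (Pi.single j 1) / deriv (ucoord (W.eps j)) (f j)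

/-- The discrete `α`-Laplacian `(Δ_α g)_i = −e^{−α u_i} Σ_j (∂K_i/∂u_j) g_j` (hyperbolic). -/
noncomputable def LapH (W : Weights S) (α : ℝ) (f : Fin N → ℝ) (g : Fin N → ℝ)
    (i : Fin N) : ℝ :=
  -exp (-(α * uOf W f i)) * ∑ j, DKH W f i j * g j

/-- The Euclidean norm on `Fin N → ℝ`. -/
noncomputable def enorm (v : Fin N → ℝ) : ℝ := Real.sqrt (∑ i, v i ^ 2)

end TriSurface

open TriSurface

/-- The determinant of the Gram matrix of a hyperbolic triangle whose edge lengths have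
hyperbolic cosines `x`, `y`, `z`. -/
def gramDet (x y z : ℝ) : ℝ := 1 + 2 * x * y * z - x ^ 2 - y ^ 2 - z ^ 2

/-- The quadratic form `∑ κ_k (x_k (v_i² + v_j²) - 2 v_i v_j)` over the edges of a triangle. -/
def edgeForm (x y z p q r a b c : ℝ) : ℝ :=
  p * (x * (b ^ 2 + c ^ 2) - 2 * b * c) + q * (y * (a ^ 2 + c ^ 2) - 2 * a * c) +
    r * (z * (a ^ 2 + b ^ 2) - 2 * a * b)

/-- With `m = G g`, the polynomial `m₁ m₂ m₃ - ∑ g_k m_i m_j`. -/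
def gramCubic (x y z g₁ g₂ g₃ : ℝ) : ℝ :=
  (g₁ + z * g₂ + y * g₃) * (z * g₁ + g₂ + x * g₃) * (y * g₁ + x * g₂ + g₃) -
    g₁ * ((z * g₁ + g₂ + x * g₃) * (y * g₁ + x * g₂ + g₃)) -
    g₂ * ((g₁ + z * g₂ + y * g₃) * (y * g₁ + x * g₂ + g₃)) -
    g₃ * ((g₁ + z * g₂ + y * g₃) * (z * g₁ + g₂ + x * g₃))

theorem gramCubic_swap (x y z g₁ g₂ g₃ : ℝ) :
    gramCubic x y z g₁ g₂ g₃ = gramCubic y x z g₂ g₁ g₃ := by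
  unfold gramCubic; ring

theorem gramCubic_rotate (x y z g₁ g₂ g₃ : ℝ) :
    gramCubic x y z g₁ g₂ g₃ = gramCubic y z x g₂ g₃ g₁ := by
  unfold gramCubic; ring

theorem gramDet_swap (x y z : ℝ) : gramDet x y z = gramDet y x z := by
  unfold gramDet; ring

theorem gramDet_rotate (x y z : ℝ) : gramDet x y z = gramDet y z x := by
  unfold gramDet; ring

theorem edgeForm_rotate (x y z p q r a b c : ℝ) :
    edgeForm x y z p q r a b c = edgeForm y z x q r p b c a := by
  unfold edgeForm; ring

/-- The determinant of `edgeForm`, multiplied by `∏ (x_i² - 1)`. -/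
theorem edgeForm_det (x y z p q r : ℝ) :
    (x ^ 2 - 1) * (y ^ 2 - 1) * (z ^ 2 - 1) *
      ((y * q + z * r) * (x * p + z * r) * (x * p + y * q) - 2 * p * q * r -
        (y * q + z * r) * p ^ 2 - (x * p + z * r) * q ^ 2 - (x * p + y * q) * r ^ 2) =
      gramCubic x y z ((x ^ 2 - 1) * p) ((y ^ 2 - 1) * q) ((z ^ 2 - 1) * r) := by
  unfold gramCubic; ring

theorem gramCubic_nonpos_of_first_eq_zero {x y z g₁ g₂ g₃ : ℝ} (hy : 1 < y) (hz : 1 < z)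
    (hG : 0 < gramDet x y z) (h₁ : 0 ≤ g₁) (h₂ : 0 ≤ g₂) (h₃ : g₃ < 0)
    (hm₁ : g₁ + z * g₂ + y * g₃ = 0) (hm₂ : 0 ≤ z * g₁ + g₂ + x * g₃) :
    gramCubic x y z g₁ g₂ g₃ ≤ 0 := by
  set m₂ := z * g₁ + g₂ + x * g₃ with hm₂'
  set m₃ := y * g₁ + x * g₂ + g₃ with hm₃'
  have hm₃ : 0 ≤ m₃ := by
    by_contra! hneg
    have e₂ : gramDet x y z * g₂ = -(y ^ 2 - 1) * m₂ + (y * z - x) * m₃ := by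
      simp only [hm₂', hm₃', gramDet]
      linear_combination (x * y - z) * hm₁
    have e₃ : gramDet x y z * g₃ = (y * z - x) * m₂ - (z ^ 2 - 1) * m₃ := by
      simp only [hm₂', hm₃', gramDet]
      linear_combination (x * z - y) * hm₁
    have e : (y ^ 2 - 1) * (z ^ 2 - 1) - (y * z - x) ^ 2 = gramDet x y z := by
      unfold gramDet; ring
    have hb : 0 < z ^ 2 - 1 := by nlinarith
    have hb' : 0 < y ^ 2 - 1 := by nlinarith
    have f₂ := mul_nonneg hG.le h₂
    have f₃ := mul_neg_of_pos_of_neg hG h₃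
    rw [e₂] at f₂
    rw [e₃] at f₃
    have hB : y * z - x < 0 := by
      by_contra! h
      nlinarith [mul_nonneg h hm₂, mul_pos hb (neg_pos.2 hneg)]
    nlinarith [mul_nonneg (neg_pos.2 hB).le f₂, mul_pos hb' (neg_pos.2 f₃),
      mul_pos hG (neg_pos.2 hneg)]
  have : gramCubic x y z g₁ g₂ g₃ = -(g₁ * (m₂ * m₃)) := by
    simp only [gramCubic, hm₁, hm₂', hm₃']; ring
  rw [this]
  exact neg_nonpos.2 (mul_nonneg h₁ (mul_nonneg hm₂ hm₃))

theorem exists_gramCubic_nonpos {x y z g₁ g₂ g₃ : ℝ} (hx : 1 < x) (hy : 1 < y) (hz : 1 < z)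
    (hG : 0 < gramDet x y z) (h₁ : 0 ≤ g₁) (h₂ : 0 ≤ g₂) (h₃ : g₃ < 0)
    (hm₁ : 0 < g₁ + z * g₂ + y * g₃) (hm₂ : 0 < z * g₁ + g₂ + x * g₃) :
    ∃ s ≤ g₃, gramCubic x y z g₁ g₂ s ≤ 0 := by
  have hx0 : 0 < x := by linarith
  have hy0 : 0 < y := by linarith
  have e₁ : y * (-(g₁ + z * g₂) / y) = -(g₁ + z * g₂) := by field_simp
  have e₂ : x * (-(z * g₁ + g₂) / x) = -(z * g₁ + g₂) := by field_simp
  have l₁ : -(g₁ + z * g₂) / y ≤ g₃ := by rw [div_le_iff₀ hy0]; linarith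
  have l₂ : -(z * g₁ + g₂) / x ≤ g₃ := by rw [div_le_iff₀ hx0]; linarith
  rcases le_total (-(z * g₁ + g₂) / x) (-(g₁ + z * g₂) / y) with h | h
  · refine ⟨_, l₁, gramCubic_nonpos_of_first_eq_zero hy hz hG h₁ h₂ (by linarith)
      (by linarith) ?_⟩
    linarith [mul_le_mul_of_nonneg_left h hx0.le]
  · refine ⟨_, l₂, ?_⟩
    rw [gramCubic_swap]
    refine gramCubic_nonpos_of_first_eq_zero hx hz (gramDet_swap x y z ▸ hG) h₂ h₁
      (by linarith) (by linarith) ?_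
    linarith [mul_le_mul_of_nonneg_left h hy0.le]

/-- A binary quadratic form with positive determinant stays of positive determinant when a
positive definite form is subtracted, provided it is negative definite. -/
theorem binary_det_pos_of_neg {n₁ n₂ n z τ : ℝ} (hz : 1 < z) (hτ : 0 ≤ τ) (hn : n₁ ≤ 0)
    (hdet : 0 < n₁ * n₂ - n ^ 2) :
    0 < (n₁ - z * τ) * (n₂ - z * τ) - (n + τ) ^ 2 := by
  have hn₁ : n₁ < 0 := lt_of_le_of_ne hn (by rintro rfl; nlinarith)
  have hn₂ : n₂ < 0 := by
    by_contra! h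
    nlinarith [mul_nonneg (neg_pos.2 hn₁).le h]
  have h2 : 2 * |n| ≤ -(n₁ + n₂) := by
    apply abs_le_of_sq_le_sq' _ (by linarith) |>.2
    rw [mul_pow, sq_abs]
    nlinarith [sq_nonneg (n₁ - n₂)]
  have h3 : 0 ≤ -z * (n₁ + n₂) - 2 * n := by nlinarith [le_abs_self n]
  nlinarith [mul_nonneg hτ h3, mul_nonneg (sq_nonneg τ) (by nlinarith : 0 ≤ z ^ 2 - 1)]

theorem edgeForm_pos_of_neg {x y z p q r : ℝ} (hx : 1 < x) (hy : 1 < y) (hz : 1 < z)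
    (hG : 0 < gramDet x y z) (hp : 0 ≤ p) (hq : 0 ≤ q) (hr : r < 0)
    (hm₁ : 0 < (x ^ 2 - 1) * p + z * ((y ^ 2 - 1) * q) + y * ((z ^ 2 - 1) * r))
    (hm₂ : 0 < z * ((x ^ 2 - 1) * p) + (y ^ 2 - 1) * q + x * ((z ^ 2 - 1) * r))
    (hD : 0 < gramCubic x y z ((x ^ 2 - 1) * p) ((y ^ 2 - 1) * q) ((z ^ 2 - 1) * r))
    {a b c : ℝ} (hv : ¬(a = 0 ∧ b = 0 ∧ c = 0)) : 0 < edgeForm x y z p q r a b c := by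
  have hbx : 0 < x ^ 2 - 1 := by nlinarith
  have hby : 0 < y ^ 2 - 1 := by nlinarith
  have hbz : 0 < z ^ 2 - 1 := by nlinarith
  have hb : 0 < (x ^ 2 - 1) * (y ^ 2 - 1) * (z ^ 2 - 1) := by positivity
  set d := x * p + y * q with hd'
  have hd : 0 < d := by
    rcases hp.lt_or_eq with h | h
    · have := mul_nonneg (by linarith : 0 ≤ y) hq
      have := mul_pos (by linarith : 0 < x) h
      linarith
    · rcases hq.lt_or_eq with h' | h'
      · have := mul_nonneg (by linarith : 0 ≤ x) hp
        have := mul_pos (by linarith : 0 < y) h'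
        linarith
      · rw [← h, ← h'] at hm₁
        nlinarith [mul_neg_of_pos_of_neg (mul_pos (by linarith : 0 < y) hbz) hr]
  set n₁ := d * (y * q + z * r) - q ^ 2 with hn₁'
  set n₂ := d * (x * p + z * r) - p ^ 2 with hn₂'
  set n := -(d * r + p * q) with hn'
  have hdet : 0 < n₁ * n₂ - n ^ 2 := by
    rw [← edgeForm_det] at hD
    have := mul_pos hd ((mul_pos_iff_of_pos_left hb).1 hD)
    refine this.trans_eq ?_
    simp only [hn₁', hn₂', hn', hd']; ring
  have hn₁ : 0 < n₁ := by
    by_contra! hneg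
    obtain ⟨s, hs, hs'⟩ := exists_gramCubic_nonpos hx hy hz hG (mul_nonneg hbx.le hp)
      (mul_nonneg hby.le hq) (mul_neg_of_pos_of_neg hbz hr) hm₁ hm₂
    obtain ⟨s, rfl⟩ : ∃ s', s = (z ^ 2 - 1) * s' := ⟨s / (z ^ 2 - 1), by field_simp⟩
    have hsr : s ≤ r := le_of_mul_le_mul_left hs hbz
    have := binary_det_pos_of_neg hz (mul_nonneg hd.le (sub_nonneg.2 hsr)) hneg hdet
    rw [← edgeForm_det] at hs'
    have h' := mul_nonpos_of_nonneg_of_nonpos hd.le (nonpos_of_mul_nonpos_right hs' hb)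
    refine absurd this (not_lt.2 (le_of_eq_of_le ?_ h'))
    simp only [hn₁', hn₂', hn', hd']; ring
  have key : n₁ * (d * edgeForm x y z p q r a b c) =
      n₁ * (d * c - q * a - p * b) ^ 2 + (n₁ * a + n * b) ^ 2 + (n₁ * n₂ - n ^ 2) * b ^ 2 := by
    simp only [hn₁', hn₂', hn', hd', edgeForm]; ring
  have hpos : 0 < n₁ * (d * edgeForm x y z p q r a b c) := by
    rw [key]
    by_cases hb0 : b = 0
    · by_cases ha0 : a = 0
      · have hc0 : c ≠ 0 := fun h => hv ⟨ha0, hb0, h⟩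
        subst hb0 ha0
        have : d * c - q * 0 - p * 0 ≠ 0 := by simpa using ⟨hd.ne', hc0⟩
        positivity
      · subst hb0
        have : n₁ * a + n * 0 ≠ 0 := by simpa using ⟨hn₁.ne', ha0⟩
        positivity
    · positivity
  exact (mul_pos_iff_of_pos_left hd).1 ((mul_pos_iff_of_pos_left hn₁).1 hpos)

theorem edgeForm_pos_of_pos_of_pos {x y z p q r : ℝ} (hx : 1 < x) (hy : 1 < y) (hz : 1 < z)
    (hp : 0 < p) (hq : 0 < q) (hr : 0 ≤ r) {a b c : ℝ} (hv : ¬(a = 0 ∧ b = 0 ∧ c = 0)) :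
    0 < edgeForm x y z p q r a b c := by
  have e : edgeForm x y z p q r a b c =
      p * (x - 1) * (b ^ 2 + c ^ 2) + q * (y - 1) * (a ^ 2 + c ^ 2) +
        r * (z - 1) * (a ^ 2 + b ^ 2) + p * (b - c) ^ 2 + q * (a - c) ^ 2 + r * (a - b) ^ 2 := by
    unfold edgeForm; ring
  have hx' := sub_pos.2 hx
  have hy' := sub_pos.2 hy
  have hz' := sub_pos.2 hz
  rw [e]
  by_cases ha : a = 0
  · by_cases hb : b = 0
    · have hc : c ≠ 0 := fun h => hv ⟨ha, hb, h⟩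
      positivity
    · positivity
  · positivity

theorem edgeForm_pos_of_nonneg {x y z p q r : ℝ} (hx : 1 < x) (hy : 1 < y) (hz : 1 < z)
    (hp : 0 ≤ p) (hq : 0 ≤ q) (hr : 0 ≤ r)
    (hD : 0 < gramCubic x y z ((x ^ 2 - 1) * p) ((y ^ 2 - 1) * q) ((z ^ 2 - 1) * r))
    {a b c : ℝ} (hv : ¬(a = 0 ∧ b = 0 ∧ c = 0)) : 0 < edgeForm x y z p q r a b c := by
  rcases hp.lt_or_eq with hp | rfl
  · rcases hq.lt_or_eq with hq | rfl
    · exact edgeForm_pos_of_pos_of_pos hx hy hz hp hq hr hv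
    · rcases hr.lt_or_eq with hr | rfl
      · rw [edgeForm_rotate, edgeForm_rotate]
        exact edgeForm_pos_of_pos_of_pos hz hx hy hr hp hq (by tauto)
      · exact absurd hD (by unfold gramCubic; ring_nf; exact lt_irrefl _)
  · rcases hq.lt_or_eq with hq | rfl
    · rcases hr.lt_or_eq with hr | rfl
      · rw [edgeForm_rotate]
        exact edgeForm_pos_of_pos_of_pos hy hz hx hq hr hp (by tauto)
      · exact absurd hD (by unfold gramCubic; ring_nf; exact lt_irrefl _)
    · exact absurd hD (by unfold gramCubic; ring_nf; exact lt_irrefl _)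

/-- The edge form of a hyperbolic triangle is positive definite as soon as at most one of the
coefficients `p`, `q`, `r` is negative. -/
theorem edgeForm_pos {x y z p q r : ℝ} (hx : 1 < x) (hy : 1 < y) (hz : 1 < z)
    (hG : 0 < gramDet x y z) (hpq : 0 ≤ p ∨ 0 ≤ q) (hqr : 0 ≤ q ∨ 0 ≤ r) (hpr : 0 ≤ p ∨ 0 ≤ r)
    (hm₁ : 0 < (x ^ 2 - 1) * p + z * ((y ^ 2 - 1) * q) + y * ((z ^ 2 - 1) * r))
    (hm₂ : 0 < z * ((x ^ 2 - 1) * p) + (y ^ 2 - 1) * q + x * ((z ^ 2 - 1) * r))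
    (hm₃ : 0 < y * ((x ^ 2 - 1) * p) + x * ((y ^ 2 - 1) * q) + (z ^ 2 - 1) * r)
    (hD : 0 < gramCubic x y z ((x ^ 2 - 1) * p) ((y ^ 2 - 1) * q) ((z ^ 2 - 1) * r))
    {a b c : ℝ} (hv : ¬(a = 0 ∧ b = 0 ∧ c = 0)) : 0 < edgeForm x y z p q r a b c := by
  rcases lt_or_ge r 0 with hr | hr
  · exact edgeForm_pos_of_neg hx hy hz hG (by grind) (by grind) hr hm₁ hm₂ hD hv
  rcases lt_or_ge p 0 with hp | hp
  · rw [edgeForm_rotate]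
    rw [gramDet_rotate] at hG
    rw [gramCubic_rotate] at hD
    exact edgeForm_pos_of_neg hy hz hx hG (by grind) hr hp (by linarith) (by linarith) hD
      (by tauto)
  rcases lt_or_ge q 0 with hq | hq
  · rw [edgeForm_rotate, edgeForm_rotate]
    rw [gramDet_rotate, gramDet_rotate] at hG
    rw [gramCubic_rotate, gramCubic_rotate] at hD
    exact edgeForm_pos_of_neg hz hx hy hG hr hp hq (by linarith) (by linarith) hD (by tauto)
  exact edgeForm_pos_of_nonneg hx hy hz hp hq hr hD hv

/-- Hyperbolic cosine of the length of the edge joining two vertices. -/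
def edgeCosh (η s₁ c₁ s₂ c₂ : ℝ) : ℝ := c₁ * c₂ + η * s₁ * s₂

theorem one_lt_edgeCosh {e₁ e₂ η s₁ c₁ s₂ c₂ : ℝ} (he₁ : e₁ = 0 ∨ e₁ = 1) (he₂ : e₂ = 0 ∨ e₂ = 1)
    (hη : 0 < e₁ * e₂ + η) (hs₁ : 0 < s₁) (hs₂ : 0 < s₂) (hc₁ : 0 < c₁) (hc₂ : 0 < c₂)
    (h₁ : c₁ ^ 2 = 1 + e₁ * s₁ ^ 2) (h₂ : c₂ ^ 2 = 1 + e₂ * s₂ ^ 2) :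
    1 < edgeCosh η s₁ c₁ s₂ c₂ := by
  have hss := mul_pos hs₁ hs₂
  have hcc := mul_pos hc₁ hc₂
  have e : (c₁ * c₂) ^ 2 = (1 + e₁ * s₁ ^ 2) * (1 + e₂ * s₂ ^ 2) := by rw [mul_pow, h₁, h₂]
  have : 1 + e₁ * e₂ * (s₁ * s₂) ≤ c₁ * c₂ := by
    refine le_of_sq_le_sq ?_ hcc.le
    rw [e]
    rcases he₁ with rfl | rfl <;> rcases he₂ with rfl | rfl <;>
      nlinarith [sq_nonneg (s₁ - s₂), sq_nonneg s₁, sq_nonneg s₂]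
  unfold edgeCosh
  nlinarith [mul_pos hη hss]

theorem edgeCosh_comm (η s₁ c₁ s₂ c₂ : ℝ) : edgeCosh η s₁ c₁ s₂ c₂ = edgeCosh η s₂ c₂ s₁ c₁ := by
  unfold edgeCosh; ring

theorem cofactor_eq {e₁ e₂ η₁ η₂ η₃ s₁ s₂ s₃ c₁ c₂ c₃ x y z : ℝ}
    (h₁ : c₁ ^ 2 = 1 + e₁ * s₁ ^ 2) (h₂ : c₂ ^ 2 = 1 + e₂ * s₂ ^ 2)
    (hx : x = edgeCosh η₁ s₂ c₂ s₃ c₃) (hy : y = edgeCosh η₂ s₁ c₁ s₃ c₃)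
    (hz : z = edgeCosh η₃ s₁ c₁ s₂ c₂) :
    (x * z - y) * c₁ + (y * z - x) * c₂ + (1 - z ^ 2) * c₃ =
      s₁ * s₂ * ((e₁ * e₂ - η₃ ^ 2) * (c₃ * s₁ * s₂) + (e₂ * η₂ + η₁ * η₃) * (c₁ * s₂ * s₃) +
        (e₁ * η₁ + η₂ * η₃) * (c₂ * s₁ * s₃)) := by
  simp only [hx, hy, hz, edgeCosh]
  linear_combination (c₃ * (c₂ ^ 2 - 1) + η₁ * c₂ * s₂ * s₃) * h₁ +
    (c₃ * e₁ * s₁ ^ 2 + η₂ * c₁ * s₁ * s₃) * h₂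

theorem eta_pos_of_sq_lt {e₁ e₂ η : ℝ} (he₁ : e₁ = 0 ∨ e₁ = 1) (he₂ : e₂ = 0 ∨ e₂ = 1)
    (hη : 0 < e₁ * e₂ + η) (h : e₁ * e₂ < η ^ 2) : 0 < η := by
  rcases he₁ with rfl | rfl <;> rcases he₂ with rfl | rfl <;> nlinarith

theorem cofactor_nonneg_or {e₁ e₂ e₃ η₁ η₂ η₃ s₁ s₂ s₃ c₁ c₂ c₃ x y z : ℝ}
    (he₁ : e₁ = 0 ∨ e₁ = 1) (he₂ : e₂ = 0 ∨ e₂ = 1) (he₃ : e₃ = 0 ∨ e₃ = 1)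
    (hη₂ : 0 < e₁ * e₃ + η₂) (hη₃ : 0 < e₁ * e₂ + η₃)
    (hγ₁ : 0 ≤ e₁ * η₁ + η₂ * η₃) (hγ₂ : 0 ≤ e₂ * η₂ + η₁ * η₃) (hγ₃ : 0 ≤ e₃ * η₃ + η₁ * η₂)
    (hs₁ : 0 < s₁) (hs₂ : 0 < s₂) (hs₃ : 0 < s₃) (hc₁ : 0 < c₁) (hc₂ : 0 < c₂) (hc₃ : 0 < c₃)
    (h₁ : c₁ ^ 2 = 1 + e₁ * s₁ ^ 2) (h₂ : c₂ ^ 2 = 1 + e₂ * s₂ ^ 2)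
    (h₃ : c₃ ^ 2 = 1 + e₃ * s₃ ^ 2)
    (hx : x = edgeCosh η₁ s₂ c₂ s₃ c₃) (hy : y = edgeCosh η₂ s₁ c₁ s₃ c₃)
    (hz : z = edgeCosh η₃ s₁ c₁ s₂ c₂) :
    0 ≤ (x * y - z) * c₁ + (1 - y ^ 2) * c₂ + (y * z - x) * c₃ ∨
      0 ≤ (x * z - y) * c₁ + (y * z - x) * c₂ + (1 - z ^ 2) * c₃ := by
  have E₃ := cofactor_eq h₁ h₂ hx hy hz
  have E₂ := cofactor_eq h₁ h₃ (hx.trans (edgeCosh_comm ..)) hz hy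
  by_contra! hcon
  obtain ⟨k₂, k₃⟩ := hcon
  rw [E₃] at k₃
  replace k₃ := neg_of_mul_neg_right k₃ (mul_pos hs₁ hs₂).le
  replace k₂ : (x * y - z) * c₁ + (z * y - x) * c₃ + (1 - y ^ 2) * c₂ < 0 := by linarith
  rw [E₂, mul_right_comm c₁ s₃ s₂] at k₂
  replace k₂ := neg_of_mul_neg_right k₂ (mul_pos hs₁ hs₃).le
  have p₁ : 0 < c₁ * s₂ * s₃ := by positivity
  have p₂ : 0 < c₂ * s₁ * s₃ := by positivity
  have p₃ : 0 < c₃ * s₁ * s₂ := by positivity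
  generalize c₁ * s₂ * s₃ = t₁ at *
  generalize c₂ * s₁ * s₃ = t₂ at *
  generalize c₃ * s₁ * s₂ = t₃ at *
  have q₃ : 0 < η₃ := by
    refine eta_pos_of_sq_lt he₁ he₂ hη₃ ?_
    by_contra! h
    nlinarith [mul_nonneg (sub_nonneg.2 h) p₃.le, mul_nonneg hγ₂ p₁.le, mul_nonneg hγ₁ p₂.le]
  have q₂ : 0 < η₂ := by
    refine eta_pos_of_sq_lt he₁ he₃ hη₂ ?_
    by_contra! h
    nlinarith [mul_nonneg (sub_nonneg.2 h) p₂.le, mul_nonneg hγ₃ p₁.le, mul_nonneg hγ₁ p₃.le]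
  have he₁' : 0 ≤ e₁ := by rcases he₁ with rfl | rfl <;> norm_num
  have r₁ := mul_neg_of_pos_of_neg q₂ k₃
  have r₂ := mul_neg_of_pos_of_neg q₃ k₂
  have t₁' := mul_nonneg (mul_nonneg he₁' hγ₂) p₃.le
  have t₂' := mul_nonneg (mul_nonneg he₁' hγ₃) p₂.le
  have t₃' := mul_nonneg (add_nonneg (mul_nonneg q₂.le hγ₂) (mul_nonneg q₃.le hγ₃)) p₁.le
  linarith

theorem two_mul_mul_le_of_bool {e e' : ℝ} (he : e = 0 ∨ e = 1) (he' : e' = 0 ∨ e' = 1) (p q : ℝ) :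
    0 ≤ e * p ^ 2 + e' * q ^ 2 - 2 * e * e' * (p * q) := by
  rcases he with rfl | rfl <;> rcases he' with rfl | rfl <;>
    linarith [sq_nonneg p, sq_nonneg q, sq_nonneg (p - q)]

theorem det_edgeCosh_deriv_pos {e₁ e₂ e₃ η₁ η₂ η₃ s₁ s₂ s₃ c₁ c₂ c₃ x y z : ℝ}
    (he₁ : e₁ = 0 ∨ e₁ = 1) (he₂ : e₂ = 0 ∨ e₂ = 1) (he₃ : e₃ = 0 ∨ e₃ = 1)
    (hη₁ : 0 < e₂ * e₃ + η₁) (hη₂ : 0 < e₁ * e₃ + η₂) (hη₃ : 0 < e₁ * e₂ + η₃)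
    (hγ₁ : 0 ≤ e₁ * η₁ + η₂ * η₃) (hγ₂ : 0 ≤ e₂ * η₂ + η₁ * η₃) (hγ₃ : 0 ≤ e₃ * η₃ + η₁ * η₂)
    (hs₁ : 0 < s₁) (hs₂ : 0 < s₂) (hs₃ : 0 < s₃) (hc₁ : 0 < c₁) (hc₂ : 0 < c₂) (hc₃ : 0 < c₃)
    (h₁ : c₁ ^ 2 = 1 + e₁ * s₁ ^ 2) (h₂ : c₂ ^ 2 = 1 + e₂ * s₂ ^ 2)
    (h₃ : c₃ ^ 2 = 1 + e₃ * s₃ ^ 2)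
    (hx : x = edgeCosh η₁ s₂ c₂ s₃ c₃) (hy : y = edgeCosh η₂ s₁ c₁ s₃ c₃)
    (hz : z = edgeCosh η₃ s₁ c₁ s₂ c₂) :
    0 < (c₂ * x - c₃) * (c₃ * y - c₁) * (c₁ * z - c₂) +
      (c₃ * x - c₂) * (c₁ * y - c₃) * (c₂ * z - c₁) := by
  have deriv_eq : ∀ {e η s c s' c' : ℝ}, c ^ 2 = 1 + e * s ^ 2 →
      c * edgeCosh η s c s' c' - c' = s * (e * s * c' + η * c * s') := by
    intro e η s c s' c' h
    unfold edgeCosh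
    linear_combination c' * h
  have f₂₃ := deriv_eq (η := η₁) (s' := s₃) (c' := c₃) h₂
  have f₃₁ := deriv_eq (η := η₂) (s' := s₁) (c' := c₁) h₃
  have f₁₂ := deriv_eq (η := η₃) (s' := s₂) (c' := c₂) h₁
  have f₃₂ := deriv_eq (η := η₁) (s' := s₂) (c' := c₂) h₃
  have f₁₃ := deriv_eq (η := η₂) (s' := s₃) (c' := c₃) h₁
  have f₂₁ := deriv_eq (η := η₃) (s' := s₁) (c' := c₁) h₂
  rw [edgeCosh_comm, ← hy] at f₃₁
  rw [edgeCosh_comm, ← hx] at f₃₂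
  rw [edgeCosh_comm, ← hz] at f₂₁
  rw [← hx] at f₂₃
  rw [← hy] at f₁₃
  rw [← hz] at f₁₂
  rw [f₂₃, f₃₁, f₁₂, f₃₂, f₁₃, f₂₁]
  have w₁ := two_mul_mul_le_of_bool he₃ he₂ (c₂ * s₃) (c₃ * s₂)
  have w₂ := two_mul_mul_le_of_bool he₃ he₁ (c₁ * s₃) (c₃ * s₁)
  have w₃ := two_mul_mul_le_of_bool he₂ he₁ (c₁ * s₂) (c₂ * s₁)
  have u₁ := mul_nonneg (mul_nonneg (mul_pos hc₁ hs₁).le hγ₁) w₁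
  have u₂ := mul_nonneg (mul_nonneg (mul_pos hc₂ hs₂).le hγ₂) w₂
  have u₃ := mul_nonneg (mul_nonneg (mul_pos hc₃ hs₃).le hγ₃) w₃
  have hprod := mul_pos (mul_pos hη₁ hη₂) hη₃
  have e : (e₂ * e₃ + η₁) * (e₁ * e₃ + η₂) * (e₁ * e₂ + η₃) =
      e₁ * e₂ * e₃ + η₁ * η₂ * η₃ + e₂ * e₃ * (e₁ * η₁ + η₂ * η₃) +
        e₁ * e₃ * (e₂ * η₂ + η₁ * η₃) + e₁ * e₂ * (e₃ * η₃ + η₁ * η₂) := by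
    rcases he₁ with rfl | rfl <;> rcases he₂ with rfl | rfl <;> rcases he₃ with rfl | rfl <;> ring
  rw [e] at hprod
  have hP : 0 < 2 * (c₁ * c₂ * c₃ * (s₁ * s₂ * s₃)) := by positivity
  have hfin := add_pos_of_pos_of_nonneg (mul_pos hP hprod) (add_nonneg (add_nonneg u₁ u₂) u₃)
  refine (mul_pos (mul_pos (mul_pos hs₁ hs₂) hs₃) hfin).trans_eq ?_
  ring

/-- Positivity of the edge form of a triangle under the structure conditions.
The coefficients are those of the derivatives of the angles. -/
theorem edgeForm_pos_of_structure {e₁ e₂ e₃ η₁ η₂ η₃ s₁ s₂ s₃ c₁ c₂ c₃ x y z : ℝ}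
    (he₁ : e₁ = 0 ∨ e₁ = 1) (he₂ : e₂ = 0 ∨ e₂ = 1) (he₃ : e₃ = 0 ∨ e₃ = 1)
    (hη₁ : 0 < e₂ * e₃ + η₁) (hη₂ : 0 < e₁ * e₃ + η₂) (hη₃ : 0 < e₁ * e₂ + η₃)
    (hγ₁ : 0 ≤ e₁ * η₁ + η₂ * η₃) (hγ₂ : 0 ≤ e₂ * η₂ + η₁ * η₃) (hγ₃ : 0 ≤ e₃ * η₃ + η₁ * η₂)
    (hs₁ : 0 < s₁) (hs₂ : 0 < s₂) (hs₃ : 0 < s₃) (hc₁ : 0 < c₁) (hc₂ : 0 < c₂) (hc₃ : 0 < c₃)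
    (h₁ : c₁ ^ 2 = 1 + e₁ * s₁ ^ 2) (h₂ : c₂ ^ 2 = 1 + e₂ * s₂ ^ 2)
    (h₃ : c₃ ^ 2 = 1 + e₃ * s₃ ^ 2)
    (hx' : x = edgeCosh η₁ s₂ c₂ s₃ c₃) (hy' : y = edgeCosh η₂ s₁ c₁ s₃ c₃)
    (hz' : z = edgeCosh η₃ s₁ c₁ s₂ c₂) (hG : 0 < gramDet x y z)
    {a b c : ℝ} (hv : ¬(a = 0 ∧ b = 0 ∧ c = 0)) :
    0 < edgeForm x y z
      (((1 - x ^ 2) * c₁ + (x * y - z) * c₂ + (x * z - y) * c₃) / (x ^ 2 - 1))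
      (((x * y - z) * c₁ + (1 - y ^ 2) * c₂ + (y * z - x) * c₃) / (y ^ 2 - 1))
      (((x * z - y) * c₁ + (y * z - x) * c₂ + (1 - z ^ 2) * c₃) / (z ^ 2 - 1)) a b c := by
  have hx : 1 < x := hx' ▸ one_lt_edgeCosh he₂ he₃ hη₁ hs₂ hs₃ hc₂ hc₃ h₂ h₃
  have hy : 1 < y := hy' ▸ one_lt_edgeCosh he₁ he₃ hη₂ hs₁ hs₃ hc₁ hc₃ h₁ h₃
  have hz : 1 < z := hz' ▸ one_lt_edgeCosh he₁ he₂ hη₃ hs₁ hs₂ hc₁ hc₂ h₁ h₂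
  have hbx : 0 < x ^ 2 - 1 := by nlinarith
  have hby : 0 < y ^ 2 - 1 := by nlinarith
  have hbz : 0 < z ^ 2 - 1 := by nlinarith
  have hdx : ∀ g, (x ^ 2 - 1) * (g / (x ^ 2 - 1)) = g := fun g => by field_simp
  have hdy : ∀ g, (y ^ 2 - 1) * (g / (y ^ 2 - 1)) = g := fun g => by field_simp
  have hdz : ∀ g, (z ^ 2 - 1) * (g / (z ^ 2 - 1)) = g := fun g => by field_simp
  have nn : ∀ {g b : ℝ}, 0 < b → 0 ≤ g → 0 ≤ g / b := fun hb hg => div_nonneg hg hb.le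
  refine edgeForm_pos hx hy hz hG ?_ ?_ ?_ ?_ ?_ ?_ ?_ hv
  · have := cofactor_nonneg_or he₃ he₁ he₂ (η₁ := η₃) (η₂ := η₁) (η₃ := η₂) (by linarith)
      (by linarith) (by linarith) (by linarith) (by linarith) hs₃ hs₁ hs₂ hc₃ hc₁ hc₂ h₃ h₁ h₂ hz'
      (hx'.trans (edgeCosh_comm ..)) (hy'.trans (edgeCosh_comm ..))
    exact this.imp (fun h => nn hbx (by linarith)) (fun h => nn hby (by linarith))
  · have := cofactor_nonneg_or he₁ he₂ he₃ hη₂ hη₃ hγ₁ hγ₂ hγ₃ hs₁ hs₂ hs₃ hc₁ hc₂ hc₃ h₁ h₂ h₃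
      hx' hy' hz'
    exact this.imp (nn hby) (nn hbz)
  · have := cofactor_nonneg_or he₂ he₃ he₁ (η₁ := η₂) (η₂ := η₃) (η₃ := η₁) (by linarith)
      (by linarith) (by linarith) (by linarith) (by linarith) hs₂ hs₃ hs₁ hc₂ hc₃ hc₁ h₂ h₃ h₁
      (hy'.trans (edgeCosh_comm ..)) (hz'.trans (edgeCosh_comm ..)) hx'
    exact this.symm.imp (fun h => nn hbx (by linarith)) (fun h => nn hbz (by linarith))
  · rw [hdx, hdy, hdz]
    refine (mul_pos hG hc₁).trans_eq ?_
    unfold gramDet; ring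
  · rw [hdx, hdy, hdz]
    refine (mul_pos hG hc₂).trans_eq ?_
    unfold gramDet; ring
  · rw [hdx, hdy, hdz]
    refine (mul_pos hG hc₃).trans_eq ?_
    unfold gramDet; ring
  · rw [hdx, hdy, hdz]
    refine (mul_pos (pow_pos hG 2) (det_edgeCosh_deriv_pos he₁ he₂ he₃ hη₁ hη₂ hη₃ hγ₁ hγ₂ hγ₃
      hs₁ hs₂ hs₃ hc₁ hc₂ hc₃ h₁ h₂ h₃ hx' hy' hz')).trans_eq ?_
    unfold gramDet gramCubic; ring

section

open Set Filter Topology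

/-- A continuous function on `[a, b]` which, at every point, either takes one of finitely many
values or has negative derivative, is antitone. -/
theorem antitoneOn_of_deriv_neg_or_mem_finite {h : ℝ → ℝ} {a b : ℝ} {Z : Set ℝ} (hZ : Z.Finite)
    (hc : ContinuousOn h (Icc a b))
    (hd : ∀ t ∈ Icc a b, h t ∈ Z ∨ ∃ h' < 0, HasDerivAt h h' t) : AntitoneOn h (Icc a b) := by
  intro s hs t ht hst
  by_contra! hlt
  obtain ⟨c, ⟨hsc, hct⟩, hcZ⟩ := (Ioo_infinite hlt).exists_notMem_finite hZ
  have hsub : Icc s t ⊆ Icc a b := Icc_subset_Icc hs.1 ht.2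
  have hcs := hc.mono hsub
  have hK : IsCompact (Icc s t ∩ h ⁻¹' {c}) :=
    isCompact_Icc.of_isClosed_subset (hcs.preimage_isClosed_of_isClosed isClosed_Icc
      isClosed_singleton) inter_subset_left
  obtain ⟨y, hy, hyc⟩ := intermediate_value_Icc hst hcs ⟨hsc.le, hct.le⟩
  obtain ⟨m, ⟨⟨hm, hmc⟩, hmin⟩⟩ := hK.exists_isLeast ⟨y, hy, hyc⟩
  simp only [mem_preimage, mem_singleton_iff] at hmc
  obtain h0 | ⟨h', hneg, hder⟩ := hd m (hsub hm)
  · exact hcZ (hmc ▸ h0)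
  have hsm : s < m := lt_of_le_of_ne hm.1 (by rintro rfl; linarith)
  have hev := (hasDerivAt_iff_tendsto_slope_left_right.1 hder).1.eventually_lt_const hneg
  obtain ⟨w, hw, hws, hwm⟩ := (hev.and (Ioo_mem_nhdsLT hsm)).exists
  have hwc : c < h w := by
    rw [slope_def_field, hmc, div_neg_iff] at hw
    rcases hw with hw | hw <;> linarith [hw.1, hw.2]
  obtain ⟨v, hv, hvc⟩ := intermediate_value_Icc hws.le
    (hcs.mono (Icc_subset_Icc le_rfl (hwm.le.trans hm.2))) ⟨hsc.le, hwc.le⟩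
  have := hmin ⟨⟨hv.1, hv.2.trans (hwm.le.trans hm.2)⟩, hvc⟩
  linarith [hv.2]

theorem lt_of_deriv_neg_or_mem_finite {h : ℝ → ℝ} {a b : ℝ} {Z : Set ℝ} (hab : a < b)
    (hZ : Z.Finite) (hc : ContinuousOn h (Icc a b))
    (hd : ∀ t ∈ Icc a b, h t ∈ Z ∨ ∃ h' < 0, HasDerivAt h h' t)
    (ha : ∃ h' < 0, HasDerivAt h h' a) : h b < h a := by
  obtain ⟨h', hneg, hder⟩ := ha
  have hev := (hasDerivAt_iff_tendsto_slope_left_right.1 hder).2.eventually_lt_const hneg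
  obtain ⟨w, hw, haw, hwb⟩ := (hev.and (Ioo_mem_nhdsGT hab)).exists
  have hlt : h w < h a := by
    rw [slope_def_field, div_neg_iff] at hw
    rcases hw with hw | hw <;> linarith [hw.1, hw.2]
  exact (antitoneOn_of_deriv_neg_or_mem_finite hZ hc hd ⟨haw.le, hwb.le⟩
    (right_mem_Icc.2 hab.le) hwb.le).trans_lt hlt

open Classical in
/-- The inverse of the coordinate change, in the form `e^f` as a function of `u`. -/
noncomputable def expOfU (e u : ℝ) : ℝ := if e = 0 then exp u else -(sinh u)⁻¹

open Classical in
/-- `√(1 + e (e^f)²)` as a function of `u`. -/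
noncomputable def coshOfU (e u : ℝ) : ℝ := if e = 0 then 1 else -(cosh u / sinh u)

theorem ucoord_neg {e : ℝ} (he : e ≠ 0) (x : ℝ) : ucoord e x < 0 := by
  rw [ucoord, if_neg he]
  have h : 1 < √(1 + exp (2 * x)) := by
    rw [lt_sqrt zero_le_one]; linarith [exp_pos (2 * x)]
  refine mul_neg_of_pos_of_neg (by norm_num) (log_neg (div_pos (by linarith) (by linarith)) ?_)
  rw [div_lt_one (by linarith)]; linarith

theorem expOfU_ucoord (e x : ℝ) : expOfU e (ucoord e x) = exp x := by
  by_cases he : e = 0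
  · simp [expOfU, ucoord, he]
  rw [expOfU, if_neg he]
  have h : 1 < √(1 + exp (2 * x)) := by
    rw [lt_sqrt zero_le_one]; linarith [exp_pos (2 * x)]
  have hC : √(1 + exp (2 * x)) ^ 2 = 1 + exp x ^ 2 := by
    rw [sq_sqrt (by positivity), ← exp_nat_mul]; norm_cast
  have hw : exp (ucoord e x) ^ 2 = (√(1 + exp (2 * x)) - 1) / (√(1 + exp (2 * x)) + 1) := by
    rw [← exp_nat_mul, ucoord, if_neg he]
    push_cast
    rw [← mul_assoc, mul_one_div_cancel two_ne_zero, one_mul,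
      exp_log (div_pos (by linarith) (by linarith))]
  generalize √(1 + exp (2 * x)) = C at *
  have hs : sinh (ucoord e x) = (exp (ucoord e x) - (exp (ucoord e x))⁻¹) / 2 := by
    rw [sinh_eq, exp_neg]
  have hpos := exp_pos (ucoord e x)
  have hE := exp_pos x
  generalize exp (ucoord e x) = w at *
  generalize exp x = E at *
  rw [eq_div_iff (by linarith)] at hw
  have hE' : E = w * (C + 1) := by
    rw [← abs_of_pos hE, ← abs_of_pos (mul_pos hpos (by linarith : 0 < C + 1)),
      ← sq_eq_sq_iff_abs_eq_abs]
    linear_combination -hC - (C + 1) * hw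
  rw [hs, ← inv_neg, inv_eq_iff_eq_inv, hE']
  have : C + 1 ≠ 0 := by linarith
  field_simp
  linear_combination -hw

theorem ucoord_injective (e : ℝ) : Function.Injective (ucoord e) := fun x y h =>
  exp_injective (by rw [← expOfU_ucoord e x, h, expOfU_ucoord])

/-- `s` and `c` are the quantities `e^f` and `√(1 + ε e^{2f})` at a vertex whose coordinate `u`
moves with velocity `v` for the time `[0, 1]`. -/
structure IsConformalPath (e v : ℝ) (s c : ℝ → ℝ) : Prop where
  s_pos : ∀ t ∈ Icc (0 : ℝ) 1, 0 < s t
  c_pos : ∀ t ∈ Icc (0 : ℝ) 1, 0 < c t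
  c_sq : ∀ t ∈ Icc (0 : ℝ) 1, c t ^ 2 = 1 + e * s t ^ 2
  hasDerivAt_s : ∀ t ∈ Icc (0 : ℝ) 1, HasDerivAt s (s t * (c t * v)) t
  hasDerivAt_c : ∀ t ∈ Icc (0 : ℝ) 1, HasDerivAt c ((c t ^ 2 - 1) * v) t

theorem isConformalPath_segment {e : ℝ} (he : e = 0 ∨ e = 1) (a b : ℝ) :
    IsConformalPath e (ucoord e b - ucoord e a)
      (fun t => expOfU e (ucoord e a + t * (ucoord e b - ucoord e a)))
      (fun t => coshOfU e (ucoord e a + t * (ucoord e b - ucoord e a))) := by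
  have hline : ∀ t, HasDerivAt (fun t => ucoord e a + t * (ucoord e b - ucoord e a))
      (ucoord e b - ucoord e a) t := fun t => by
    simpa using ((hasDerivAt_id t).mul_const (ucoord e b - ucoord e a)).const_add (ucoord e a)
  rcases he with rfl | rfl
  · simp only [expOfU, coshOfU, if_true]
    exact ⟨fun t _ => exp_pos _, fun t _ => one_pos, fun t _ => by ring,
      fun t _ => by simpa using (hline t).exp, fun t _ => by simpa using hasDerivAt_const t 1⟩
  · have hneg : ∀ t ∈ Icc (0 : ℝ) 1, sinh (ucoord 1 a + t * (ucoord 1 b - ucoord 1 a)) < 0 := by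
      intro t ht
      rw [sinh_neg_iff]
      have ha := ucoord_neg one_ne_zero a
      have hb := ucoord_neg one_ne_zero b
      rcases ht.1.lt_or_eq with h | rfl
      · nlinarith [mul_nonneg (sub_nonneg.2 ht.2) (neg_pos.2 ha).le, mul_pos h (neg_pos.2 hb)]
      · simpa using ha
    simp only [expOfU, coshOfU, one_ne_zero, if_false]
    refine ⟨fun t ht => neg_pos.2 (inv_lt_zero.2 (hneg t ht)),
      fun t ht => neg_pos.2 (div_neg_of_pos_of_neg (cosh_pos _) (hneg t ht)), fun t ht => ?_,
      fun t ht => ?_, fun t ht => ?_⟩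
    · have := (hneg t ht).ne
      field_simp
      linear_combination cosh_sq (ucoord 1 a + t * (ucoord 1 b - ucoord 1 a))
    · have := (hneg t ht).ne
      refine ((hline t).sinh.inv this).neg.congr_deriv ?_
      field_simp
    · have := (hneg t ht).ne
      refine ((hline t).cosh.div (hline t).sinh this).neg.congr_deriv ?_
      field_simp
      ring

/-- The angle opposite to the edge `x` in a generalized hyperbolic triangle whose edge lengths have
hyperbolic cosines `x`, `y`, `z`.  It is `π` or `0` when the triangle inequalities fail, since
`arccos` is constant outside `[-1, 1]`. -/
noncomputable def gramAngle (x y z : ℝ) : ℝ :=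
  arccos ((y * z - x) / (√(y ^ 2 - 1) * √(z ^ 2 - 1)))

theorem gramAngle_comm (x y z : ℝ) : gramAngle x y z = gramAngle x z y := by
  unfold gramAngle; rw [mul_comm y z, mul_comm (√_)]

theorem sqrt_sq_sub_one_pos {y : ℝ} (hy : 1 < y) : 0 < √(y ^ 2 - 1) :=
  sqrt_pos.2 (by nlinarith)

theorem one_sub_cos_sq_eq {x y z : ℝ} (hy : 1 < y) (hz : 1 < z) :
    1 - ((y * z - x) / (√(y ^ 2 - 1) * √(z ^ 2 - 1))) ^ 2 =
      gramDet x y z / (√(y ^ 2 - 1) * √(z ^ 2 - 1)) ^ 2 := by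
  have hY := sqrt_sq_sub_one_pos hy
  have hZ := sqrt_sq_sub_one_pos hz
  have hY2 : √(y ^ 2 - 1) ^ 2 = y ^ 2 - 1 := sq_sqrt (by nlinarith)
  have hZ2 : √(z ^ 2 - 1) ^ 2 = z ^ 2 - 1 := sq_sqrt (by nlinarith)
  field_simp
  rw [hY2, hZ2]
  unfold gramDet; ring

theorem gramAngle_eq_zero_or_pi {x y z : ℝ} (hy : 1 < y) (hz : 1 < z) (hG : gramDet x y z ≤ 0) :
    gramAngle x y z = 0 ∨ gramAngle x y z = π := by
  have h : 1 ≤ ((y * z - x) / (√(y ^ 2 - 1) * √(z ^ 2 - 1))) ^ 2 := by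
    rw [← sub_nonpos, one_sub_cos_sq_eq hy hz]
    exact div_nonpos_of_nonpos_of_nonneg hG (sq_nonneg _)
  rw [one_le_sq_iff_one_le_abs, le_abs] at h
  rw [gramAngle]
  exact h.imp arccos_of_one_le fun h => arccos_of_le_neg_one (by linarith)

theorem hasDerivAt_gramAngle {x y z : ℝ → ℝ} {x' y' z' t : ℝ} (hx : HasDerivAt x x' t)
    (hy : HasDerivAt y y' t) (hz : HasDerivAt z z' t) (hy1 : 1 < y t) (hz1 : 1 < z t)
    (hG : 0 < gramDet (x t) (y t) (z t)) :
    HasDerivAt (fun t => gramAngle (x t) (y t) (z t))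
      ((x' - (x t * y t - z t) / (y t ^ 2 - 1) * y' - (x t * z t - y t) / (z t ^ 2 - 1) * z') /
        √(gramDet (x t) (y t) (z t))) t := by
  have hY := sqrt_sq_sub_one_pos hy1
  have hZ := sqrt_sq_sub_one_pos hz1
  have hY2 : √(y t ^ 2 - 1) ^ 2 = y t ^ 2 - 1 := sq_sqrt (by nlinarith)
  have hZ2 : √(z t ^ 2 - 1) ^ 2 = z t ^ 2 - 1 := sq_sqrt (by nlinarith)
  have hD := sqrt_pos.2 hG
  have e := one_sub_cos_sq_eq (x := x t) hy1 hz1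
  have hpos : 0 < 1 - ((y t * z t - x t) / (√(y t ^ 2 - 1) * √(z t ^ 2 - 1))) ^ 2 := by
    rw [e]; positivity
  have dy : HasDerivAt (fun τ => √(y τ ^ 2 - 1)) (y t * y' / √(y t ^ 2 - 1)) t :=
    (((hy.fun_pow 2).sub_const 1).sqrt (show y t ^ 2 - 1 ≠ 0 by nlinarith)).congr_deriv (by
      field_simp; norm_num; ring)
  have dz : HasDerivAt (fun τ => √(z τ ^ 2 - 1)) (z t * z' / √(z t ^ 2 - 1)) t :=
    (((hz.fun_pow 2).sub_const 1).sqrt (show z t ^ 2 - 1 ≠ 0 by nlinarith)).congr_deriv (by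
      field_simp; norm_num; ring)
  have dr := ((hy.fun_mul hz).fun_sub hx).fun_div (dy.fun_mul dz) (mul_pos hY hZ).ne'
  have := (hasDerivAt_arccos (fun h => by
    rw [h] at hpos; norm_num at hpos) (fun h => by rw [h] at hpos; norm_num at hpos)).comp t dr
  refine this.congr_deriv ?_
  rw [e, sqrt_div' _ (sq_nonneg _), sqrt_sq (mul_pos hY hZ).le, ← hY2, ← hZ2]
  simp only [sqrt_sq hY.le, sqrt_sq hZ.le]
  generalize √(y t ^ 2 - 1) = Y at *
  generalize √(z t ^ 2 - 1) = Z at *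
  field_simp
  linear_combination -z t * y' * Z ^ 2 * hY2 - y t * z' * Y ^ 2 * hZ2

theorem hasDerivAt_edgeCosh {e₁ e₂ η v₁ v₂ t : ℝ} {s₁ c₁ s₂ c₂ : ℝ → ℝ}
    (p₁ : IsConformalPath e₁ v₁ s₁ c₁) (p₂ : IsConformalPath e₂ v₂ s₂ c₂)
    (ht : t ∈ Icc (0 : ℝ) 1) :
    HasDerivAt (fun t => edgeCosh η (s₁ t) (c₁ t) (s₂ t) (c₂ t))
      ((c₁ t * v₁ + c₂ t * v₂) * edgeCosh η (s₁ t) (c₁ t) (s₂ t) (c₂ t) -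
        (v₁ * c₂ t + c₁ t * v₂)) t := by
  refine (((p₁.hasDerivAt_c t ht).fun_mul (p₂.hasDerivAt_c t ht)).fun_add
    (((p₁.hasDerivAt_s t ht).const_mul η).fun_mul (p₂.hasDerivAt_s t ht))).congr_deriv ?_
  unfold edgeCosh; ring

/-- The derivative of the angle sum of a triangle weighted by the velocities `v₁`, `v₂`, `v₃`. -/
theorem weighted_angle_deriv_eq {x y z c₁ c₂ c₃ v₁ v₂ v₃ x' y' z' : ℝ} (hx : 1 < x) (hy : 1 < y)
    (hz : 1 < z) (hx' : x' = (c₂ * v₂ + c₃ * v₃) * x - (v₂ * c₃ + c₂ * v₃))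
    (hy' : y' = (c₁ * v₁ + c₃ * v₃) * y - (v₁ * c₃ + c₁ * v₃))
    (hz' : z' = (c₁ * v₁ + c₂ * v₂) * z - (v₁ * c₂ + c₁ * v₂)) :
    v₁ * (x' - (x * y - z) / (y ^ 2 - 1) * y' - (x * z - y) / (z ^ 2 - 1) * z') +
      v₂ * (y' - (y * x - z) / (x ^ 2 - 1) * x' - (y * z - x) / (z ^ 2 - 1) * z') +
      v₃ * (z' - (z * x - y) / (x ^ 2 - 1) * x' - (z * y - x) / (y ^ 2 - 1) * y') =
    -edgeForm x y z
      (((1 - x ^ 2) * c₁ + (x * y - z) * c₂ + (x * z - y) * c₃) / (x ^ 2 - 1))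
      (((x * y - z) * c₁ + (1 - y ^ 2) * c₂ + (y * z - x) * c₃) / (y ^ 2 - 1))
      (((x * z - y) * c₁ + (y * z - x) * c₂ + (1 - z ^ 2) * c₃) / (z ^ 2 - 1)) v₁ v₂ v₃ := by
  have h1 : x ^ 2 - 1 ≠ 0 := by nlinarith
  have h2 : y ^ 2 - 1 ≠ 0 := by nlinarith
  have h3 : z ^ 2 - 1 ≠ 0 := by nlinarith
  subst hx' hy' hz'
  unfold edgeForm
  field_simp
  ring

/-- Along a segment in the `u`-coordinates, the angle sum of a nondegenerate triangle weighted by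
the velocity decreases, even if the triangle degenerates on the way. -/
theorem weighted_angle_sum_lt {e₁ e₂ e₃ η₁ η₂ η₃ v₁ v₂ v₃ : ℝ} {s₁ s₂ s₃ c₁ c₂ c₃ x y z : ℝ → ℝ}
    (he₁ : e₁ = 0 ∨ e₁ = 1) (he₂ : e₂ = 0 ∨ e₂ = 1) (he₃ : e₃ = 0 ∨ e₃ = 1)
    (hη₁ : 0 < e₂ * e₃ + η₁) (hη₂ : 0 < e₁ * e₃ + η₂) (hη₃ : 0 < e₁ * e₂ + η₃)
    (hγ₁ : 0 ≤ e₁ * η₁ + η₂ * η₃) (hγ₂ : 0 ≤ e₂ * η₂ + η₁ * η₃) (hγ₃ : 0 ≤ e₃ * η₃ + η₁ * η₂)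
    (p₁ : IsConformalPath e₁ v₁ s₁ c₁) (p₂ : IsConformalPath e₂ v₂ s₂ c₂)
    (p₃ : IsConformalPath e₃ v₃ s₃ c₃)
    (hx : ∀ t, x t = edgeCosh η₁ (s₂ t) (c₂ t) (s₃ t) (c₃ t))
    (hy : ∀ t, y t = edgeCosh η₂ (s₁ t) (c₁ t) (s₃ t) (c₃ t))
    (hz : ∀ t, z t = edgeCosh η₃ (s₁ t) (c₁ t) (s₂ t) (c₂ t))
    (hG : 0 < gramDet (x 0) (y 0) (z 0)) (hv : ¬(v₁ = 0 ∧ v₂ = 0 ∧ v₃ = 0)) :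
    v₁ * gramAngle (x 1) (y 1) (z 1) + v₂ * gramAngle (y 1) (x 1) (z 1) +
        v₃ * gramAngle (z 1) (x 1) (y 1) <
      v₁ * gramAngle (x 0) (y 0) (z 0) + v₂ * gramAngle (y 0) (x 0) (z 0) +
        v₃ * gramAngle (z 0) (x 0) (y 0) := by
  have hx1 : ∀ t ∈ Icc (0 : ℝ) 1, 1 < x t := fun t ht => hx t ▸ one_lt_edgeCosh he₂ he₃ hη₁
    (p₂.s_pos t ht) (p₃.s_pos t ht) (p₂.c_pos t ht) (p₃.c_pos t ht) (p₂.c_sq t ht) (p₃.c_sq t ht)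
  have hy1 : ∀ t ∈ Icc (0 : ℝ) 1, 1 < y t := fun t ht => hy t ▸ one_lt_edgeCosh he₁ he₃ hη₂
    (p₁.s_pos t ht) (p₃.s_pos t ht) (p₁.c_pos t ht) (p₃.c_pos t ht) (p₁.c_sq t ht) (p₃.c_sq t ht)
  have hz1 : ∀ t ∈ Icc (0 : ℝ) 1, 1 < z t := fun t ht => hz t ▸ one_lt_edgeCosh he₁ he₂ hη₃
    (p₁.s_pos t ht) (p₂.s_pos t ht) (p₁.c_pos t ht) (p₂.c_pos t ht) (p₁.c_sq t ht) (p₂.c_sq t ht)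
  obtain rfl := funext hx
  obtain rfl := funext hy
  obtain rfl := funext hz
  set x := fun t => edgeCosh η₁ (s₂ t) (c₂ t) (s₃ t) (c₃ t)
  set y := fun t => edgeCosh η₂ (s₁ t) (c₁ t) (s₃ t) (c₃ t)
  set z := fun t => edgeCosh η₃ (s₁ t) (c₁ t) (s₂ t) (c₂ t)
  have hD : ∀ t ∈ Icc (0 : ℝ) 1, 0 < gramDet (x t) (y t) (z t) → ∃ h' < 0, HasDerivAt (fun t =>
      v₁ * gramAngle (x t) (y t) (z t) + v₂ * gramAngle (y t) (x t) (z t) +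
        v₃ * gramAngle (z t) (x t) (y t)) h' t := by
    intro t ht hGt
    have dx : HasDerivAt x ((c₂ t * v₂ + c₃ t * v₃) * x t - (v₂ * c₃ t + c₂ t * v₃)) t :=
      hasDerivAt_edgeCosh p₂ p₃ ht
    have dy : HasDerivAt y ((c₁ t * v₁ + c₃ t * v₃) * y t - (v₁ * c₃ t + c₁ t * v₃)) t :=
      hasDerivAt_edgeCosh p₁ p₃ ht
    have dz : HasDerivAt z ((c₁ t * v₁ + c₂ t * v₂) * z t - (v₁ * c₂ t + c₁ t * v₂)) t :=
      hasDerivAt_edgeCosh p₁ p₂ ht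
    have g₂ : gramDet (y t) (x t) (z t) = gramDet (x t) (y t) (z t) := by unfold gramDet; ring
    have g₃ : gramDet (z t) (x t) (y t) = gramDet (x t) (y t) (z t) := by unfold gramDet; ring
    have a₁ := hasDerivAt_gramAngle dx dy dz (hy1 t ht) (hz1 t ht) hGt
    have a₂ := hasDerivAt_gramAngle dy dx dz (hx1 t ht) (hz1 t ht) (g₂ ▸ hGt)
    have a₃ := hasDerivAt_gramAngle dz dx dy (hx1 t ht) (hy1 t ht) (g₃ ▸ hGt)
    refine ⟨_, ?_, ((a₁.const_mul v₁).fun_add (a₂.const_mul v₂)).fun_add (a₃.const_mul v₃)⟩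
    rw [g₂, g₃]
    simp only [← mul_div_assoc, ← add_div]
    refine div_neg_of_neg_of_pos ?_ (sqrt_pos.2 hGt)
    rw [weighted_angle_deriv_eq (hx1 t ht) (hy1 t ht) (hz1 t ht) rfl rfl rfl]
    exact neg_neg_of_pos (edgeForm_pos_of_structure he₁ he₂ he₃ hη₁ hη₂ hη₃ hγ₁ hγ₂ hγ₃
      (p₁.s_pos t ht) (p₂.s_pos t ht) (p₃.s_pos t ht) (p₁.c_pos t ht) (p₂.c_pos t ht)
      (p₃.c_pos t ht) (p₁.c_sq t ht) (p₂.c_sq t ht) (p₃.c_sq t ht) rfl rfl rfl hGt hv)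
  have cx : ContinuousOn x (Icc 0 1) := fun t ht =>
    (hasDerivAt_edgeCosh p₂ p₃ ht).continuousAt.continuousWithinAt
  have cy : ContinuousOn y (Icc 0 1) := fun t ht =>
    (hasDerivAt_edgeCosh p₁ p₃ ht).continuousAt.continuousWithinAt
  have cz : ContinuousOn z (Icc 0 1) := fun t ht =>
    (hasDerivAt_edgeCosh p₁ p₂ ht).continuousAt.continuousWithinAt
  have cont : ∀ {x y z : ℝ → ℝ}, ContinuousOn x (Icc 0 1) → ContinuousOn y (Icc 0 1) →
      ContinuousOn z (Icc 0 1) → (∀ t ∈ Icc (0 : ℝ) 1, 1 < y t) → (∀ t ∈ Icc (0 : ℝ) 1, 1 < z t) →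
      ContinuousOn (fun t => gramAngle (x t) (y t) (z t)) (Icc 0 1) := fun cx cy cz hy hz =>
    continuous_arccos.comp_continuousOn (((cy.mul cz).sub cx).div
      (((cy.pow 2).sub continuousOn_const).sqrt.mul ((cz.pow 2).sub continuousOn_const).sqrt)
      fun t ht => (mul_pos (sqrt_sq_sub_one_pos (hy t ht)) (sqrt_sq_sub_one_pos (hz t ht))).ne')
  have hfin : ({0, π} : Set ℝ).Finite := toFinite _
  refine lt_of_deriv_neg_or_mem_finite (h := fun t =>
      v₁ * gramAngle (x t) (y t) (z t) + v₂ * gramAngle (y t) (x t) (z t) +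
        v₃ * gramAngle (z t) (x t) (y t)) zero_lt_one
    ((hfin.prod (hfin.prod hfin)).image fun q : ℝ × ℝ × ℝ => v₁ * q.1 + v₂ * q.2.1 + v₃ * q.2.2)
    ?_ (fun t ht => ?_) (hD 0 (left_mem_Icc.2 zero_le_one) hG)
  · exact ((continuousOn_const.mul (cont cx cy cz hy1 hz1)).add
      (continuousOn_const.mul (cont cy cx cz hx1 hz1))).add
      (continuousOn_const.mul (cont cz cx cy hx1 hy1))
  · rcases lt_or_ge 0 (gramDet (x t) (y t) (z t)) with h | h
    · exact Or.inr (hD t ht h)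
    · have g₂ : gramDet (y t) (x t) (z t) ≤ 0 := by unfold gramDet at *; linarith
      have g₃ : gramDet (z t) (x t) (y t) ≤ 0 := by unfold gramDet at *; linarith
      exact Or.inl ⟨(_, _, _), ⟨gramAngle_eq_zero_or_pi (hy1 t ht) (hz1 t ht) h,
        gramAngle_eq_zero_or_pi (hx1 t ht) (hz1 t ht) g₂,
        gramAngle_eq_zero_or_pi (hx1 t ht) (hy1 t ht) g₃⟩, rfl⟩

/-- `√(1 + ε e^{2f})` is determined along a conformal path. -/
theorem IsConformalPath.eq_sqrt {e v t : ℝ} {s c : ℝ → ℝ} (p : IsConformalPath e v s c)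
    (ht : t ∈ Icc (0 : ℝ) 1) : c t = √(1 + e * s t ^ 2) := by
  rw [← p.c_sq t ht, sqrt_sq (p.c_pos t ht).le]

/-- The hyperbolic cosine of the edge length. -/
noncomputable def coshLength {N : ℕ} {S : TriSurface N} (W : Weights S) (f : Fin N → ℝ)
    (i j : Fin N) : ℝ :=
  edgeCosh (W.eta i j) (exp (f i)) √(1 + W.eps i * exp (f i) ^ 2)
    (exp (f j)) √(1 + W.eps j * exp (f j) ^ 2)

theorem sinh_eq_sqrt_cosh_sq_sub_one {a : ℝ} (ha : 0 ≤ a) : sinh a = √(cosh a ^ 2 - 1) := by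
  rw [cosh_sq, add_sub_cancel_right, sqrt_sq (sinh_nonneg_iff.2 ha)]

theorem gramDet_cosh (a b c : ℝ) : gramDet (cosh a) (cosh b) (cosh c) =
    (cosh (b + c) - cosh a) * (cosh a - cosh (b - c)) := by
  unfold gramDet
  rw [cosh_add, cosh_sub]
  linear_combination (cosh c ^ 2 - 1) * cosh_sq b + sinh b ^ 2 * cosh_sq c

theorem gramDet_cosh_pos {a b c : ℝ} (ha : a < b + c) (hb : b < a + c) (hc : c < a + b) :
    0 < gramDet (cosh a) (cosh b) (cosh c) := by
  rw [gramDet_cosh]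
  refine mul_pos (sub_pos.2 (cosh_lt_cosh.2 ?_)) (sub_pos.2 (cosh_lt_cosh.2 ?_))
  · rwa [abs_of_pos (by linarith : 0 < a), abs_of_pos (by linarith : 0 < b + c)]
  · rw [abs_of_pos (by linarith : 0 < a), abs_lt]; constructor <;> linarith

section Face

variable {N : ℕ} {S : TriSurface N} (W : Weights S) (f : Fin N → ℝ) {i j k : Fin N}

theorem lH_eq_arcosh (i j : Fin N) : lH W f i j = Real.arcosh (coshLength W f i j) := by
  have h : ∀ l, 0 ≤ 1 + W.eps l * exp (f l) ^ 2 := fun l => by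
    rcases W.eps01 l with h | h <;> rw [h] <;> positivity
  have h2 : ∀ l, exp (2 * f l) = exp (f l) ^ 2 := fun l => by rw [← exp_nat_mul]; norm_cast
  rw [lH, TriSurface.arcosh, Real.arcosh, coshLength, edgeCosh, h2, h2, sqrt_mul (h i), exp_add,
    mul_assoc]

theorem coshLength_comm (i j : Fin N) : coshLength W f i j = coshLength W f j i := by
  rw [coshLength, edgeCosh_comm, W.eta_symm, coshLength]

theorem edge_mem {σ : Finset (Fin N)} (hσ : σ ∈ S.F) (hi : i ∈ σ) (hj : j ∈ σ) (hij : i ≠ j) :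
    ({i, j} : Finset (Fin N)) ∈ S.edges :=
  Finset.mem_biUnion.2 ⟨σ, hσ, Finset.mem_powersetCard.2
    ⟨Finset.insert_subset hi (Finset.singleton_subset_iff.2 hj), Finset.card_pair hij⟩⟩

theorem one_lt_coshLength (h : ({i, j} : Finset (Fin N)) ∈ S.edges) : 1 < coshLength W f i j := by
  have h1 : ∀ l, 0 < 1 + W.eps l * exp (f l) ^ 2 := fun l => by
    rcases W.eps01 l with h | h <;> rw [h] <;> positivity
  exact one_lt_edgeCosh (W.eps01 i) (W.eps01 j) (W.structCond1 i j h) (exp_pos _) (exp_pos _)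
    (sqrt_pos.2 (h1 i)) (sqrt_pos.2 (h1 j)) (sq_sqrt (h1 i).le) (sq_sqrt (h1 j).le)

theorem lH_pos (h : ({i, j} : Finset (Fin N)) ∈ S.edges) : 0 < lH W f i j := by
  rw [lH_eq_arcosh]; exact Real.arcosh_pos (one_lt_coshLength W f h)

theorem cosh_lH (h : ({i, j} : Finset (Fin N)) ∈ S.edges) :
    cosh (lH W f i j) = coshLength W f i j := by
  rw [lH_eq_arcosh, Real.cosh_arcosh (one_lt_coshLength W f h).le]

theorem thetaH_eq_gramAngle (hij : ({i, j} : Finset (Fin N)) ∈ S.edges)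
    (hik : ({i, k} : Finset (Fin N)) ∈ S.edges) (hjk : ({j, k} : Finset (Fin N)) ∈ S.edges) :
    thetaH W f i j k =
      gramAngle (coshLength W f j k) (coshLength W f i j) (coshLength W f i k) := by
  rw [thetaH, gramAngle, sinh_eq_sqrt_cosh_sq_sub_one (lH_pos W f hij).le,
    sinh_eq_sqrt_cosh_sq_sub_one (lH_pos W f hik).le, cosh_lH W f hij, cosh_lH W f hik,
    cosh_lH W f hjk]

theorem thetaExH_eq_thetaH (hij : ({i, j} : Finset (Fin N)) ∈ S.edges)
    (hik : ({i, k} : Finset (Fin N)) ∈ S.edges) (hjk : ({j, k} : Finset (Fin N)) ∈ S.edges) :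
    thetaExH W f i j k = thetaH W f i j k := by
  have b := lH_pos W f hij
  have c := lH_pos W f hik
  have a := lH_pos W f hjk
  have hpos := mul_pos (sinh_pos_iff.2 b) (sinh_pos_iff.2 c)
  unfold thetaExH
  split_ifs with h h'
  · rfl
  · refine (arccos_of_le_neg_one ?_).symm
    rw [div_le_iff₀ hpos]
    have : cosh (lH W f i j + lH W f i k) ≤ cosh (lH W f j k) :=
      cosh_le_cosh.2 (abs_le_abs_of_nonneg (by linarith) h')
    rw [cosh_add] at this
    linarith
  · refine (arccos_of_one_le ?_).symm
    rw [one_le_div hpos]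
    have : cosh (lH W f j k) ≤ cosh (lH W f i j - lH W f i k) := by
      rw [cosh_le_cosh, abs_of_pos a, le_abs]
      by_contra! h2
      exact h ⟨by linarith, by linarith [h2.2], by linarith [h2.1]⟩
    rw [cosh_sub] at this
    linarith

theorem faceAngleExH_eq_gramAngle (hσ : ({i, j, k} : Finset (Fin N)) ∈ S.F) (hij : i ≠ j)
    (hik : i ≠ k) (hjk : j ≠ k) : faceAngleExH W f i {i, j, k} =
      gramAngle (coshLength W f j k) (coshLength W f i j) (coshLength W f i k) := by
  have eij : ({i, j} : Finset (Fin N)) ∈ S.edges := edge_mem hσ (by simp) (by simp) hij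
  have eik : ({i, k} : Finset (Fin N)) ∈ S.edges := edge_mem hσ (by simp) (by simp) hik
  have ejk : ({j, k} : Finset (Fin N)) ∈ S.edges := edge_mem hσ (by simp) (by simp) hjk
  have ekj : ({k, j} : Finset (Fin N)) ∈ S.edges := Finset.pair_comm j k ▸ ejk
  have e₁ : ({i, j, k} : Finset (Fin N)).erase i = {j, k} :=
    Finset.erase_insert (by simp [hij, hik])
  have e₂ : ({j, k} : Finset (Fin N)).erase j = {k} := Finset.erase_insert (by simp [hjk])
  have e₃ : ({j, k} : Finset (Fin N)).erase k = {j} := by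
    rw [Finset.pair_comm]; exact Finset.erase_insert (by simp [hjk.symm])
  rw [faceAngleExH, e₁, Finset.sum_pair hjk, e₂, e₃, Finset.sum_singleton, Finset.sum_singleton,
    thetaExH_eq_thetaH W f eij eik ejk, thetaExH_eq_thetaH W f eik eij ekj,
    thetaH_eq_gramAngle W f eij eik ejk, thetaH_eq_gramAngle W f eik eij ekj,
    gramAngle_comm _ (coshLength W f i k), coshLength_comm W f k j]
  ring

theorem sum_mul_faceAngleExH (v : Fin N → ℝ) (hσ : ({i, j, k} : Finset (Fin N)) ∈ S.F)
    (hij : i ≠ j) (hik : i ≠ k) (hjk : j ≠ k) :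
    ∑ l ∈ ({i, j, k} : Finset (Fin N)), v l * faceAngleExH W f l {i, j, k} =
      v i * gramAngle (coshLength W f j k) (coshLength W f i k) (coshLength W f i j) +
      v j * gramAngle (coshLength W f i k) (coshLength W f j k) (coshLength W f i j) +
      v k * gramAngle (coshLength W f i j) (coshLength W f j k) (coshLength W f i k) := by
  have e₂ : ({i, j, k} : Finset (Fin N)) = {j, i, k} := Finset.insert_comm _ _ _
  have e₃ : ({i, j, k} : Finset (Fin N)) = {k, i, j} := by
    rw [Finset.insert_comm k i, Finset.pair_comm k j]
  rw [Finset.sum_insert (by simp [hij, hik]), Finset.sum_pair hjk,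
    faceAngleExH_eq_gramAngle W f hσ hij hik hjk, e₂,
    faceAngleExH_eq_gramAngle W f (e₂ ▸ hσ) hij.symm hjk hik, ← e₂, e₃,
    faceAngleExH_eq_gramAngle W f (e₃ ▸ hσ) hik.symm hjk.symm hij,
    gramAngle_comm _ (coshLength W f i j), gramAngle_comm _ (coshLength W f j i),
    gramAngle_comm _ (coshLength W f k i), coshLength_comm W f j i, coshLength_comm W f k i,
    coshLength_comm W f k j, add_assoc]

theorem gramDet_coshLength_pos {f} (hf : admissibleH W f) (hσ : ({i, j, k} : Finset (Fin N)) ∈ S.F)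
    (hij : i ≠ j) (hik : i ≠ k) (hjk : j ≠ k) :
    0 < gramDet (coshLength W f j k) (coshLength W f i k) (coshLength W f i j) := by
  have e₂ : ({i, j, k} : Finset (Fin N)) = {j, i, k} := Finset.insert_comm _ _ _
  have e₃ : ({i, j, k} : Finset (Fin N)) = {k, i, j} := by
    rw [Finset.insert_comm k i, Finset.pair_comm k j]
  have comm : ∀ i j, lH W f i j = lH W f j i := fun i j => by
    rw [lH_eq_arcosh, lH_eq_arcosh, coshLength_comm]
  have h₁ := hf i j k hσ
  have h₂ := hf j i k (e₂ ▸ hσ)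
  have h₃ := hf k i j (e₃ ▸ hσ)
  rw [comm j i] at h₂
  rw [comm k i, comm k j] at h₃
  rw [← cosh_lH W f (edge_mem hσ (by simp) (by simp) hjk),
    ← cosh_lH W f (edge_mem hσ (by simp) (by simp) hik),
    ← cosh_lH W f (edge_mem hσ (by simp) (by simp) hij)]
  exact gramDet_cosh_pos (by linarith) (by linarith) (by linarith)

end Face

theorem sum_mul_faceAngleExH_lt {N : ℕ} {S : TriSurface N} (W : Weights S) {f g : Fin N → ℝ}
    (hf : admissibleH W f) {σ : Finset (Fin N)} (hσ : σ ∈ S.F)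
    (hne : ∃ i ∈ σ, uOf W g i - uOf W f i ≠ 0) :
    ∑ i ∈ σ, (uOf W g i - uOf W f i) * faceAngleExH W g i σ <
      ∑ i ∈ σ, (uOf W g i - uOf W f i) * faceAngleExH W f i σ := by
  obtain ⟨i, j, k, hij, hik, hjk, rfl⟩ := Finset.card_eq_three.1 (S.card_face σ hσ)
  have eij := edge_mem hσ (i := i) (j := j) (by simp) (by simp) hij
  have eik := edge_mem hσ (i := i) (j := k) (by simp) (by simp) hik
  have ejk := edge_mem hσ (i := j) (j := k) (by simp) (by simp) hjk
  have e₂ : ({i, j, k} : Finset (Fin N)) = {j, i, k} := Finset.insert_comm _ _ _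
  have e₃ : ({i, j, k} : Finset (Fin N)) = {k, i, j} := by
    rw [Finset.insert_comm k i, Finset.pair_comm k j]
  rw [sum_mul_faceAngleExH W g _ hσ hij hik hjk, sum_mul_faceAngleExH W f _ hσ hij hik hjk]
  have p : ∀ l, IsConformalPath (W.eps l) (uOf W g l - uOf W f l) _ _ := fun l =>
    isConformalPath_segment (W.eps01 l) (f l) (g l)
  have at0 : ∀ l m, edgeCosh (W.eta l m) _ _ _ _ = coshLength W f l m := fun l m => by
    have hl := (p l).eq_sqrt (left_mem_Icc.2 zero_le_one)
    have hm := (p m).eq_sqrt (left_mem_Icc.2 zero_le_one)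
    simp only [zero_mul, add_zero, expOfU_ucoord] at hl hm
    rw [coshLength, ← hl, ← hm]
  have at1 : ∀ l m, edgeCosh (W.eta l m) _ _ _ _ = coshLength W g l m := fun l m => by
    have hl := (p l).eq_sqrt (right_mem_Icc.2 zero_le_one)
    have hm := (p m).eq_sqrt (right_mem_Icc.2 zero_le_one)
    simp only [one_mul, add_sub_cancel, expOfU_ucoord] at hl hm
    rw [coshLength, ← hl, ← hm]
  have c₂ := W.structCond2 j i k (e₂ ▸ hσ) hij.symm hjk hik
  have c₃ := W.structCond2 k i j (e₃ ▸ hσ) hik.symm hjk.symm hij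
  rw [W.eta_symm j i, mul_comm (W.eta i j)] at c₂
  rw [W.eta_symm k i, W.eta_symm k j, mul_comm (W.eta i k)] at c₃
  have c₁ := W.structCond2 i j k hσ hij hik hjk
  rw [mul_comm (W.eta i j)] at c₁
  have key := weighted_angle_sum_lt (W.eps01 i) (W.eps01 j) (W.eps01 k)
    (W.structCond1 j k ejk) (W.structCond1 i k eik) (W.structCond1 i j eij) c₁ c₂ c₃
    (p i) (p j) (p k) (fun _ => rfl) (fun _ => rfl) (fun _ => rfl)
  simp only [zero_mul, add_zero, one_mul, add_sub_cancel, expOfU_ucoord] at key at0 at1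
  simp only [at0, at1] at key
  refine key (gramDet_coshLength_pos W hf hσ hij hik hjk) ?_
  rintro ⟨h₁, h₂, h₃⟩
  obtain ⟨l, hl, hne⟩ := hne
  simp only [Finset.mem_insert, Finset.mem_singleton] at hl
  rcases hl with rfl | rfl | rfl <;> exact hne ‹_›

theorem KExH_eq {N : ℕ} {S : TriSurface N} {W : Weights S} {α : ℝ} {f R : Fin N → ℝ}
    (h : ∀ i, RExH W α f i = R i) (i : Fin N) : KExH W f i = R i * exp (α * uOf W f i) := by
  rw [← h i, RExH, mul_assoc, ← exp_add, neg_add_cancel, exp_zero, mul_one]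

theorem sum_mul_KExH {N : ℕ} {S : TriSurface N} (W : Weights S) (f v : Fin N → ℝ) :
    ∑ i, v i * KExH W f i =
      ∑ i, v i * (2 * π) - ∑ σ ∈ S.F, ∑ i ∈ σ, v i * faceAngleExH W f i σ := by
  simp only [KExH, mul_sub, Finset.sum_sub_distrib, Finset.mul_sum]
  congr 1
  exact Finset.sum_comm' (by simp [and_comm])

theorem mul_mul_exp_sub_nonpos {α R : ℝ} (h : α * R ≤ 0) (a b : ℝ) :
    (b - a) * (R * exp (α * b) - R * exp (α * a)) ≤ 0 := by
  rcases eq_or_ne α 0 with rfl | hα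
  · simp
  have hP : 0 ≤ (α * b - α * a) * (exp (α * b) - exp (α * a)) := by
    rcases le_total (α * a) (α * b) with h | h
    · exact mul_nonneg (sub_nonneg.2 h) (sub_nonneg.2 (exp_le_exp.2 h))
    · exact mul_nonneg_of_nonpos_of_nonpos (sub_nonpos.2 h) (sub_nonpos.2 (exp_le_exp.2 h))
  refine nonpos_of_mul_nonpos_right ?_ (sq_pos_of_ne_zero hα)
  calc _ = (α * R) * ((α * b - α * a) * (exp (α * b) - exp (α * a))) := by ring
    _ ≤ 0 := mul_nonpos_of_nonpos_of_nonneg h hP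

end

/-- hyperbolic rigidity of the extended combinatorial `α`-curvature.
Let `α R̄_i ≤ 0` for all `i`.  If `f_A` is admissible, `f_B` is arbitrary, and both have
the same extended combinatorial `α`-curvature `R̄`, then `f_A = f_B`. -/
theorem hyperbolic_alpha_rigidity {N : ℕ} (S : TriSurface N) (W : TriSurface.Weights S)
    (α : ℝ) (Rbar : Fin N → ℝ) (hαR : ∀ i, α * Rbar i ≤ 0)
    (fA fB : Fin N → ℝ) (hA : admissibleH W fA)
    (hRA : ∀ i, RExH W α fA i = Rbar i) (hRB : ∀ i, RExH W α fB i = Rbar i) :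
    fA = fB := by
  by_contra hne
  have hu : ∃ i, uOf W fB i - uOf W fA i ≠ 0 := by
    by_contra! h
    exact hne (funext fun i => ucoord_injective _ (sub_eq_zero.1 (h i)).symm)
  obtain ⟨i₀, hi₀⟩ := hu
  obtain ⟨σ₀, hσ₀, hiσ₀⟩ := S.vertex_cover i₀
  have hlt : ∑ σ ∈ S.F, ∑ i ∈ σ, (uOf W fB i - uOf W fA i) * faceAngleExH W fB i σ <
      ∑ σ ∈ S.F, ∑ i ∈ σ, (uOf W fB i - uOf W fA i) * faceAngleExH W fA i σ := by
    refine Finset.sum_lt_sum (fun σ hσ => ?_)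
      ⟨σ₀, hσ₀, sum_mul_faceAngleExH_lt W hA hσ₀ ⟨i₀, hiσ₀, hi₀⟩⟩
    by_cases h : ∃ i ∈ σ, uOf W fB i - uOf W fA i ≠ 0
    · exact (sum_mul_faceAngleExH_lt W hA hσ h).le
    · push Not at h
      exact (Finset.sum_congr rfl fun i hi => by rw [h i hi, zero_mul, zero_mul]).le
  have hle : ∑ i, (uOf W fB i - uOf W fA i) * (KExH W fB i - KExH W fA i) ≤ 0 :=
    Finset.sum_nonpos fun i _ => by
      rw [KExH_eq hRA, KExH_eq hRB]
      exact mul_mul_exp_sub_nonpos (hαR i) _ _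
  rw [Finset.sum_congr rfl fun i _ => mul_sub _ _ _, Finset.sum_sub_distrib, sum_mul_KExH,
    sum_mul_KExH] at hle
  linarith
end

section
/- Let α ≠ 0. (i) If u : [0,T) → U^E is a C¹ solution of the normalized combinatorial α-Ricci flow du_i/dt = 2πχ / (Σ_{j=1}^N e^{α u_j}) − R_{α,i}(u), then the function t ↦ Σ_{i=1}^N e^{α u_i(t)} is constant on [0,T). (ii) The same quantity Σ_{i=1}^N e^{α u_i(t)} is constant along any C¹ solution u : [0,T) → U^E of the combinatorial α-Calabi flow du_i/dt = (Δ_α R_α)_i, where (Δ_α g)_i := −e^{−α u_i} Σ_{j=1}^N (∂K_i/∂u_j) g_j. -/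
open Real

open TriSurface

/-- The angles of a nondegenerate Euclidean triangle, given by the law of cosines from its
side lengths, add up to `π`. -/
theorem arccos_add_arccos_add_arccos_eq_pi {a b c : ℝ} (habc : c < a + b) (hbca : a < b + c)
    (hcab : b < c + a) :
    arccos ((b ^ 2 + c ^ 2 - a ^ 2) / (2 * b * c)) +
      arccos ((c ^ 2 + a ^ 2 - b ^ 2) / (2 * c * a)) +
      arccos ((a ^ 2 + b ^ 2 - c ^ 2) / (2 * a * b)) = π := by
  have ha : 0 < a := by linarith
  have hb : 0 < b := by linarith
  have hc : 0 < c := by linarith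
  set D : ℝ := (a + b + c) * (b + c - a) * (c + a - b) * (a + b - c) with hD
  have hDpos : 0 < D := by
    have h1 : 0 < b + c - a := by linarith
    have h2 : 0 < c + a - b := by linarith
    have h3 : 0 < a + b - c := by linarith
    positivity
  have hss : √D * √D = D := Real.mul_self_sqrt hDpos.le
  have sin_eq : ∀ x y z : ℝ, 0 < x → 0 < y →
      D = (2 * x * y) ^ 2 - (x ^ 2 + y ^ 2 - z ^ 2) ^ 2 →
      sin (arccos ((x ^ 2 + y ^ 2 - z ^ 2) / (2 * x * y))) = √D / (2 * x * y) := by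
    intro x y z hx hy h
    have hxy : (0 : ℝ) < 2 * x * y := by positivity
    rw [Real.sin_arccos]
    have : 1 - ((x ^ 2 + y ^ 2 - z ^ 2) / (2 * x * y)) ^ 2 = D / (2 * x * y) ^ 2 := by
      rw [h]; field_simp
    rw [this, Real.sqrt_div hDpos.le, Real.sqrt_sq hxy.le]
  have cos_eq : ∀ x y z : ℝ, 0 < x → 0 < y → z < x + y → x < y + z → y < z + x →
      cos (arccos ((x ^ 2 + y ^ 2 - z ^ 2) / (2 * x * y))) =
        (x ^ 2 + y ^ 2 - z ^ 2) / (2 * x * y) := by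
    intro x y z hx hy h1 h2 h3
    have hxy : (0 : ℝ) < 2 * x * y := by positivity
    apply Real.cos_arccos
    · rw [le_div_iff₀ hxy]; nlinarith
    · rw [div_le_iff₀ hxy]; nlinarith
  have sA := sin_eq b c a hb hc (by rw [hD]; ring)
  have sB := sin_eq c a b hc ha (by rw [hD]; ring)
  have cA := cos_eq b c a hb hc hbca hcab habc
  have cB := cos_eq c a b hc ha hcab habc hbca
  set A := arccos ((b ^ 2 + c ^ 2 - a ^ 2) / (2 * b * c))
  set B := arccos ((c ^ 2 + a ^ 2 - b ^ 2) / (2 * c * a))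
  have hA0 : 0 ≤ A := Real.arccos_nonneg _
  have hB0 : 0 ≤ B := Real.arccos_nonneg _
  have hA1 : A ≤ π := Real.arccos_le_pi _
  have hB1 : B ≤ π := Real.arccos_le_pi _
  have hsin : 0 < sin (A + B) := by
    have : sin (A + B) = √D / (2 * a * b) := by
      rw [Real.sin_add, sA, sB, cA, cB]; field_simp; ring
    rw [this]; positivity
  have hlt : A + B ≤ π := by
    by_contra! h
    have : sin (A + B - 2 * π) ≤ 0 :=
      Real.sin_nonpos_of_nonpos_of_neg_pi_le (by linarith) (by linarith)
    rw [Real.sin_sub_two_pi] at this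
    linarith
  have hcos : cos (π - (A + B)) = (a ^ 2 + b ^ 2 - c ^ 2) / (2 * a * b) := by
    rw [Real.cos_pi_sub, Real.cos_add, sA, sB, cA, cB]
    have : √D / (2 * b * c) * (√D / (2 * c * a)) = D / (2 * b * c * (2 * c * a)) := by
      rw [div_mul_div_comm, hss]
    rw [this, hD]; field_simp; ring
  rw [← hcos, Real.arccos_cos (by linarith) (by linarith)]
  ring

namespace TriSurface

variable {N : ℕ} {S : TriSurface N}

theorem lE_comm (W : Weights S) (u : Fin N → ℝ) (i j : Fin N) : lE W u i j = lE W u j i := by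
  unfold lE
  rw [W.eta_symm i j, add_comm (u i) (u j), add_comm (W.eps i * _)]

theorem thetaE_comm (W : Weights S) (u : Fin N → ℝ) (i j k : Fin N) :
    thetaE W u i j k = thetaE W u i k j := by
  unfold thetaE
  rw [lE_comm W u j k, add_comm (lE W u i j ^ 2), mul_right_comm]

/-- The three strict triangle inequalities in an admissible face. -/
theorem admissibleE.triangle {W : Weights S} {u : Fin N → ℝ} (h : admissibleE W u)
    {i j k : Fin N} (hF : ({i, j, k} : Finset (Fin N)) ∈ S.F) :
    lE W u j k < lE W u i j + lE W u i k ∧ lE W u i k < lE W u i j + lE W u j k ∧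
      lE W u i j < lE W u i k + lE W u j k := by
  refine ⟨h i j k hF, ?_, ?_⟩
  · have hF' : ({j, i, k} : Finset (Fin N)) ∈ S.F := by rwa [Finset.insert_comm]
    have := h j i k hF'
    rwa [lE_comm W u j i] at this
  · have hF' : ({k, i, j} : Finset (Fin N)) ∈ S.F := by
      rwa [Finset.insert_comm, Finset.pair_comm k j]
    have := h k i j hF'
    rwa [lE_comm W u k i, lE_comm W u k j] at this

theorem thetaE_add_thetaE_add_thetaE {W : Weights S} {u : Fin N → ℝ} (h : admissibleE W u)
    {i j k : Fin N} (hF : ({i, j, k} : Finset (Fin N)) ∈ S.F) :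
    thetaE W u i j k + thetaE W u j k i + thetaE W u k i j = π := by
  obtain ⟨h1, h2, h3⟩ := h.triangle hF
  rw [← arccos_add_arccos_add_arccos_eq_pi (a := lE W u j k) (b := lE W u i j)
    (c := lE W u i k) (by linarith) (by linarith) (by linarith)]
  unfold thetaE
  rw [lE_comm W u k i, lE_comm W u k j, lE_comm W u j i]
  ring_nf

theorem faceAngleE_eq_thetaE (W : Weights S) (u : Fin N → ℝ) {i j k : Fin N} (hij : i ≠ j)
    (hik : i ≠ k) (hjk : j ≠ k) {σ : Finset (Fin N)} (hσ : σ = {i, j, k}) :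
    faceAngleE W u i σ = thetaE W u i j k := by
  classical
  have h1 : σ.erase i = {j, k} := by
    rw [hσ]; ext x; simp only [Finset.mem_erase, Finset.mem_insert, Finset.mem_singleton]
    grind
  have h2 : ({j, k} : Finset (Fin N)).erase j = {k} := by
    ext x; simp only [Finset.mem_erase, Finset.mem_insert, Finset.mem_singleton]
    grind
  have h3 : ({j, k} : Finset (Fin N)).erase k = {j} := by
    ext x; simp only [Finset.mem_erase, Finset.mem_insert, Finset.mem_singleton]
    grind
  have : faceAngleE W u i σ =
      (1 / 2) * ∑ j ∈ σ.erase i, ∑ k ∈ (σ.erase i).erase j, thetaE W u i j k := by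
    unfold faceAngleE
    congr!
  rw [this, h1, Finset.sum_pair hjk, h2, h3, Finset.sum_singleton, Finset.sum_singleton,
    thetaE_comm W u i k j]
  ring

theorem sum_faceAngleE {W : Weights S} {u : Fin N → ℝ} (h : admissibleE W u)
    {σ : Finset (Fin N)} (hσ : σ ∈ S.F) : ∑ i ∈ σ, faceAngleE W u i σ = π := by
  obtain ⟨i, j, k, hij, hik, hjk, rfl⟩ := Finset.card_eq_three.1 (S.card_face σ hσ)
  rw [Finset.sum_insert (by simp [hij, hik]), Finset.sum_pair hjk,
    faceAngleE_eq_thetaE W u hij hik hjk rfl,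
    faceAngleE_eq_thetaE W u hjk hij.symm hik.symm (by ext; simp; tauto),
    faceAngleE_eq_thetaE W u hik.symm hjk.symm hij (by ext; simp; tauto),
    ← add_assoc, thetaE_add_thetaE_add_thetaE h hσ]

theorem two_mul_card_edges (S : TriSurface N) : S.edges.card * 2 = S.F.card * 3 := by
  classical
  refine Finset.card_mul_eq_card_mul (fun e σ => e ⊆ σ) ?_ ?_
  · intro e he
    obtain ⟨σ, hσ, heσ⟩ := Finset.mem_biUnion.1 he
    rw [Finset.mem_powersetCard] at heσ
    rw [← S.edge_two_faces e heσ.2 ⟨σ, hσ, heσ.1⟩]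
    unfold Finset.bipartiteAbove
    congr!
  · intro σ hσ
    have : Finset.bipartiteBelow (fun e σ => e ⊆ σ) S.edges σ = Finset.powersetCard 2 σ := by
      ext e
      simp only [Finset.mem_bipartiteBelow, edges, Finset.mem_biUnion,
        Finset.mem_powersetCard]
      grind
    rw [this, Finset.card_powersetCard, S.card_face σ hσ]
    rfl

theorem two_mul_chi (S : TriSurface N) : 2 * (S.chi : ℝ) = 2 * N - S.F.card := by
  have h : (S.edges.card : ℝ) * 2 = S.F.card * 3 := mod_cast S.two_mul_card_edges
  unfold chi
  push_cast
  linarith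

/-- The combinatorial Gauss-Bonnet formula. -/
theorem sum_KE {W : Weights S} {u : Fin N → ℝ} (h : admissibleE W u) :
    ∑ i, KE W u i = 2 * π * S.chi := by
  classical
  have h1 : ∑ i, ∑ σ ∈ S.F.filter (fun σ => i ∈ σ), faceAngleE W u i σ = S.F.card * π := by
    rw [Finset.sum_comm' (t' := S.F) (s' := fun σ => σ) (by simp; tauto),
      Finset.sum_congr rfl fun σ hσ => sum_faceAngleE h hσ]
    simp
  have h2 : ∑ i, KE W u i =
      ∑ i : Fin N, (2 * π - ∑ σ ∈ S.F.filter (fun σ => i ∈ σ), faceAngleE W u i σ) := by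
    unfold KE
    congr!
  rw [h2, Finset.sum_sub_distrib, h1, mul_right_comm, S.two_mul_chi]
  simp
  ring

theorem continuous_lE (W : Weights S) (i j : Fin N) : Continuous fun u => lE W u i j := by
  unfold lE
  fun_prop

theorem differentiableAt_lE {W : Weights S} {u : Fin N → ℝ} {i j : Fin N}
    (h : 0 < lE W u i j) : DifferentiableAt ℝ (fun v => lE W v i j) u := by
  have h' := (Real.sqrt_pos.1 h).ne'
  unfold lE
  exact DifferentiableAt.sqrt (by fun_prop) h'

theorem differentiableAt_thetaE {W : Weights S} {u : Fin N → ℝ} (h : admissibleE W u)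
    {i j k : Fin N} (hF : ({i, j, k} : Finset (Fin N)) ∈ S.F) :
    DifferentiableAt ℝ (fun v => thetaE W v i j k) u := by
  obtain ⟨h1, h2, h3⟩ := h.triangle hF
  have hij : 0 < lE W u i j := by linarith
  have hik : 0 < lE W u i k := by linarith
  have hjk : 0 < lE W u j k := by linarith
  have hpos : 0 < 2 * lE W u i j * lE W u i k := by positivity
  have dij := differentiableAt_lE hij
  have dik := differentiableAt_lE hik
  have djk := differentiableAt_lE hjk
  have hlt : (lE W u i j ^ 2 + lE W u i k ^ 2 - lE W u j k ^ 2) /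
      (2 * lE W u i j * lE W u i k) < 1 := by
    rw [div_lt_iff₀ hpos]; nlinarith
  have hgt : -1 < (lE W u i j ^ 2 + lE W u i k ^ 2 - lE W u j k ^ 2) /
      (2 * lE W u i j * lE W u i k) := by
    rw [lt_div_iff₀ hpos]; nlinarith
  have hquot : DifferentiableAt ℝ (fun v => (lE W v i j ^ 2 + lE W v i k ^ 2 - lE W v j k ^ 2) /
      (2 * lE W v i j * lE W v i k)) u := by
    fun_prop (disch := exact hpos.ne')
  have harccos := Real.differentiableAt_arccos.2 ⟨hgt.ne', hlt.ne⟩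
  exact harccos.comp (f := fun v => (lE W v i j ^ 2 + lE W v i k ^ 2 - lE W v j k ^ 2) /
      (2 * lE W v i j * lE W v i k)) u hquot

theorem differentiableAt_KE {W : Weights S} {u : Fin N → ℝ} (h : admissibleE W u)
    (i : Fin N) : DifferentiableAt ℝ (fun v => KE W v i) u := by
  unfold KE
  refine DifferentiableAt.const_sub (DifferentiableAt.fun_sum fun σ hσ => ?_) _
  obtain ⟨hσ, hi⟩ := Finset.mem_filter.1 hσ
  obtain ⟨a, b, c, hab, hac, hbc, rfl⟩ := Finset.card_eq_three.1 (S.card_face σ hσ)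
  have key : ∀ j k, i ≠ j → i ≠ k → j ≠ k → ({a, b, c} : Finset (Fin N)) = {i, j, k} →
      DifferentiableAt ℝ (fun v => faceAngleE W v i {a, b, c}) u := by
    intro j k hij hik hjk he
    simp only [faceAngleE_eq_thetaE W _ hij hik hjk he]
    exact differentiableAt_thetaE h (he ▸ hσ)
  simp only [Finset.mem_insert, Finset.mem_singleton] at hi
  rcases hi with rfl | rfl | rfl
  · exact key b c hab hac hbc rfl
  · exact key a c hab.symm hbc hac (by ext; simp; tauto)
  · exact key a b hac.symm hbc.symm hab (by ext; simp; tauto)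

theorem isOpen_setOf_admissibleE (W : Weights S) : IsOpen {u | admissibleE W u} := by
  have : {u | admissibleE W u} =
      ⋂ (i : Fin N) (j : Fin N) (k : Fin N) (_ : ({i, j, k} : Finset (Fin N)) ∈ S.F),
        {u | lE W u j k < lE W u i j + lE W u i k} := by
    ext u
    simp [admissibleE]
  rw [this]
  exact isOpen_iInter_of_finite fun i => isOpen_iInter_of_finite fun j =>
    isOpen_iInter_of_finite fun k => isOpen_iInter_of_finite fun _ =>
      isOpen_lt (continuous_lE W j k) ((continuous_lE W i j).add (continuous_lE W i k))

theorem sum_DKE {W : Weights S} {u : Fin N → ℝ} (h : admissibleE W u) (j : Fin N) :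
    ∑ i, DKE W u i j = 0 := by
  have h1 : fderiv ℝ (fun v => ∑ i, KE W v i) u = 0 := by
    have : (fun v => ∑ i, KE W v i) =ᶠ[nhds u] fun _ => 2 * π * (S.chi : ℝ) :=
      Filter.eventually_of_mem ((isOpen_setOf_admissibleE W).mem_nhds h) fun v hv => sum_KE hv
    rw [this.fderiv_eq, fderiv_fun_const]
    rfl
  rw [fderiv_fun_sum fun i _ => differentiableAt_KE h i] at h1
  have h2 := congrArg (fun L => L (Pi.single j 1)) h1
  simpa [DKE] using h2

/-- If the velocity of a curve is orthogonal to the gradient of `∑ e^{α u_i}`, then this sum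
is constant along the curve. -/
theorem sum_exp_eq_of_hasDerivWithinAt {α T : ℝ} (hT : 0 < T) {u v : ℝ → Fin N → ℝ}
    (hu : ∀ t ∈ Set.Ico (0 : ℝ) T, ∀ i,
      HasDerivWithinAt (fun s => u s i) (v t i) (Set.Ico (0 : ℝ) T) t)
    (hv : ∀ t ∈ Set.Ico (0 : ℝ) T, ∑ i, exp (α * u t i) * v t i = 0) :
    ∀ t ∈ Set.Ico (0 : ℝ) T, ∑ i, exp (α * u t i) = ∑ i, exp (α * u 0 i) := by
  have hd : ∀ t ∈ Set.Ico (0 : ℝ) T,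
      HasDerivWithinAt (fun s => ∑ i, exp (α * u s i)) 0 (Set.Ico (0 : ℝ) T) t := by
    intro t ht
    have h : HasDerivWithinAt (fun s => ∑ i, exp (α * u s i))
        (∑ i, exp (α * u t i) * (α * v t i)) (Set.Ico (0 : ℝ) T) t :=
      HasDerivWithinAt.fun_sum fun i _ => ((hu t ht i).const_mul α).exp
    convert h using 1
    simp_rw [mul_left_comm _ α, ← Finset.mul_sum, hv t ht, mul_zero]
  intro t ht
  have := (convex_Ico (0 : ℝ) T).norm_image_sub_le_of_norm_hasDerivWithin_le (C := 0) hd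
    (by simp) (Set.left_mem_Ico.2 hT) ht
  rw [zero_mul, norm_le_zero_iff, sub_eq_zero] at this
  exact this

end TriSurface

/-- conserved quantity of the Euclidean `α`-flows, `α ≠ 0`.
Along any `C¹` solution `u : [0,T) → U^E` of the normalized combinatorial `α`-Ricci flow
`du_i/dt = 2πχ/(Σ_j e^{α u_j}) − R_{α,i}(u)`, and along any `C¹` solution of the
combinatorial `α`-Calabi flow `du_i/dt = (Δ_α R_α)_i`, the quantity `Σ_i e^{α u_i(t)}`
is constant. -/
theorem euclidean_flows_invariant {N : ℕ} (S : TriSurface N) (W : TriSurface.Weights S)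
    (α : ℝ) (hα : α ≠ 0) (T : ℝ) (hT : 0 < T) (u : ℝ → Fin N → ℝ)
    (hadm : ∀ t ∈ Set.Ico (0 : ℝ) T, admissibleE W (u t)) :
    ((∀ t ∈ Set.Ico (0 : ℝ) T, ∀ i, HasDerivWithinAt (fun s => u s i)
        (2 * π * (S.chi : ℝ) / (∑ j, exp (α * u t j)) - RE W α (u t) i)
        (Set.Ico (0 : ℝ) T) t) →
      ∀ t ∈ Set.Ico (0 : ℝ) T, ∑ i, exp (α * u t i) = ∑ i, exp (α * u 0 i)) ∧
    ((∀ t ∈ Set.Ico (0 : ℝ) T, ∀ i, HasDerivWithinAt (fun s => u s i)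
        (LapE W α (u t) (RE W α (u t)) i) (Set.Ico (0 : ℝ) T) t) →
      ∀ t ∈ Set.Ico (0 : ℝ) T, ∑ i, exp (α * u t i) = ∑ i, exp (α * u 0 i)) := by
  constructor
  · intro h
    refine sum_exp_eq_of_hasDerivWithinAt hT h fun t ht => ?_
    obtain ⟨σ, hσ⟩ := S.F_nonempty
    obtain ⟨i₀, -⟩ := Finset.card_pos.1 (by rw [S.card_face σ hσ]; norm_num)
    have hpos : 0 < ∑ j, exp (α * u t j) :=
      Finset.sum_pos (fun j _ => exp_pos _) ⟨i₀, Finset.mem_univ _⟩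
    have hK : ∀ i, exp (α * u t i) * RE W α (u t) i = KE W (u t) i := by
      intro i
      rw [RE, mul_left_comm, ← Real.exp_add, add_neg_cancel, Real.exp_zero, mul_one]
    simp_rw [mul_sub, hK, Finset.sum_sub_distrib, ← Finset.sum_mul, sum_KE (hadm t ht)]
    rw [mul_div_cancel₀ _ hpos.ne', sub_self]
  · intro h
    refine sum_exp_eq_of_hasDerivWithinAt hT h fun t ht => ?_
    have hL : ∀ i, exp (α * u t i) * LapE W α (u t) (RE W α (u t)) i =
        -∑ j, DKE W (u t) i j * RE W α (u t) j := by
      intro i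
      rw [LapE, neg_mul, mul_neg, ← mul_assoc, ← Real.exp_add, add_neg_cancel, Real.exp_zero,
        one_mul]
    simp_rw [hL, Finset.sum_neg_distrib]
    rw [Finset.sum_comm]
    simp_rw [← Finset.sum_mul, sum_DKE (hadm t ht)]
    simp
end
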